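/- Suppose that under the flow one has ω(t) = 0 for all t ∈ [0,T). Then (d/dt) ∫_γ k_{ss}² ds ≤ [ −2 + (74 L(t)³/π³) ‖k_s(·,t)‖₂² + (174 L(t)⁶/π⁶) ‖k_s(·,t)‖₂⁴ ] ‖k_{s⁵}(·,t)‖₂² − (3/L(t)) ‖k_{ss}(·,t)‖₂⁴ for all t ∈ [0,T). -/

import Mathlib

noncomputable section

open Real Set MeasureTheory intervalIntegral
open scoped ENNReal RealInnerProductSpace

/-- The Euclidean plane. -/
abbrev E2 : Type := EuclideanSpace ℝ (Fin 2)

/-- Counterclockwise rotation by `π/2`. -/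
def rot (v : E2) : E2 := (WithLp.equiv 2 (Fin 2 → ℝ)).symm ![-(v 1), v 0]

/-- Arc length derivative `∂ₛ = |∂ₓγ|⁻¹ ∂ₓ` of a scalar function along the curve `γ`. -/
def aderiv (γ : ℝ → E2) (f : ℝ → ℝ) (x : ℝ) : ℝ := (‖deriv γ x‖)⁻¹ * deriv f x

/-- Iterated arc length derivative. -/
def aderivIter (γ : ℝ → E2) : ℕ → (ℝ → ℝ) → (ℝ → ℝ)
  | 0, f => f
  | n + 1, f => aderiv γ (aderivIter γ n f)

/-- Arc length derivative of a vector-valued function along `γ`. -/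
def aderivVec (γ : ℝ → E2) (f : ℝ → E2) (x : ℝ) : E2 := (‖deriv γ x‖)⁻¹ • deriv f x

/-- Unit tangent vector `τ = ∂ₛ γ`. -/
def utangent (γ : ℝ → E2) (x : ℝ) : E2 := aderivVec γ γ x

/-- Unit normal `ν`, the counterclockwise rotation of `τ` by `π/2`. -/
def unormal (γ : ℝ → E2) (x : ℝ) : E2 := rot (utangent γ x)

/-- Scalar curvature `k = ⟨∂ₛτ, ν⟩`. -/
def curv (γ : ℝ → E2) (x : ℝ) : ℝ := ⟪aderivVec γ (utangent γ) x, unormal γ x⟫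

/-- `j`-th arc length derivative of the curvature, `k_{s^j}`. -/
def kds (γ : ℝ → E2) (j : ℕ) : ℝ → ℝ := aderivIter γ j (curv γ)

/-- The normal speed `F = k_{s⁴} + k² k_{ss} - (1/2) k k_s²`. -/
def speedF (γ : ℝ → E2) (x : ℝ) : ℝ :=
  kds γ 4 x + (curv γ x) ^ 2 * kds γ 2 x - (1 / 2) * curv γ x * (kds γ 1 x) ^ 2

/-- `∫_γ f ds`, the integral of `f` along `γ : [-1,1] → ℝ²` with respect to arc length. -/
def cint (γ : ℝ → E2) (f : ℝ → ℝ) : ℝ := ∫ x in (-1:ℝ)..1, f x * ‖deriv γ x‖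

/-- The length of `γ`. -/
def clen (γ : ℝ → E2) : ℝ := cint γ (fun _ => 1)

/-- `‖k_{s^j}‖₂² = ∫_γ k_{s^j}² ds`. -/
def knorm2 (γ : ℝ → E2) (j : ℕ) : ℝ := cint γ (fun x => (kds γ j x) ^ 2)

/-- Total curvature `∫_γ k ds`. -/
def totalK (γ : ℝ → E2) : ℝ := cint γ (curv γ)

/-- The time interval `[0, T)`, `T ∈ (0, ∞]`. -/
def inTime (T : ℝ≥0∞) (t : ℝ) : Prop := 0 ≤ t ∧ ENNReal.ofReal t < T

/-- A smooth family of regular plane curves `γ : [-1,1] × [0,T) → ℝ²` moving with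
normal speed `F = k_{s⁴} + k² k_{ss} - (1/2) k k_s²`, i.e. `∂ₜγ = F ν`. -/
structure SixthFlow (T : ℝ≥0∞) where
  Tpos : 0 < T
  γ : ℝ → ℝ → E2
  smooth : ContDiff ℝ (⊤ : ℕ∞) (Function.uncurry γ)
  regular : ∀ ⦃t x : ℝ⦄, inTime T t → x ∈ Icc (-1:ℝ) 1 → deriv (γ t) x ≠ 0
  flow : ∀ ⦃t x : ℝ⦄, inTime T t → x ∈ Icc (-1:ℝ) 1 →
    HasDerivWithinAt (fun u => γ u x) (speedF (γ t) x • unormal (γ t) x) (Ici 0) t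

/-- The boundary conditions: the endpoints of the curve lie on two fixed parallel vertical
lines at distance `|e| > 0` (at abscissae `lineMinus` and `linePlus`), the curve meets these
lines perpendicularly (Neumann condition: the unit normal of the curve is orthogonal to the
unit normal `(1,0)` of the lines), and `k_s = k_{sss} = 0` at both endpoints. -/
structure BC {T : ℝ≥0∞} (Φ : SixthFlow T) (e : ℝ) where
  he : e ≠ 0
  lineMinus : ℝ
  linePlus : ℝ
  hdist : |linePlus - lineMinus| = |e|
  onLeft : ∀ ⦃t : ℝ⦄, inTime T t → Φ.γ t (-1) 0 = lineMinus
  onRight : ∀ ⦃t : ℝ⦄, inTime T t → Φ.γ t 1 0 = linePlus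
  neumann : ∀ ⦃t : ℝ⦄, inTime T t →
    unormal (Φ.γ t) (-1) 0 = 0 ∧ unormal (Φ.γ t) 1 0 = 0
  noflux : ∀ ⦃t : ℝ⦄, inTime T t →
    kds (Φ.γ t) 1 (-1) = 0 ∧ kds (Φ.γ t) 1 1 = 0
  noflux3 : ∀ ⦃t : ℝ⦄, inTime T t →
    kds (Φ.γ t) 3 (-1) = 0 ∧ kds (Φ.γ t) 3 1 = 0

section WeightedCalculus

variable {v : ℝ → ℝ}

lemma intervalIntegrable_of_continuousOn_Icc {f : ℝ → ℝ} (hf : ContinuousOn f (Icc (-1) 1)) :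
    IntervalIntegrable f volume (-1) 1 := by
  apply ContinuousOn.intervalIntegrable
  rwa [uIcc_of_le (by norm_num)]

lemma weighted_integral_nonneg (hv : ∀ x ∈ Icc (-1:ℝ) 1, 0 < v x) {f : ℝ → ℝ}
    (hf : ∀ x ∈ Icc (-1:ℝ) 1, 0 ≤ f x) : 0 ≤ ∫ x in (-1:ℝ)..1, f x * v x :=
  intervalIntegral.integral_nonneg (by norm_num) fun x hx => mul_nonneg (hf x hx) (hv x hx).le

/-- The fundamental theorem of calculus for `∂ₛ = v⁻¹ ∂ₓ`. -/
lemma weighted_integral_deriv (hvc : ContinuousOn v (Icc (-1) 1)) {f g : ℝ → ℝ}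
    (hg : ContinuousOn g (Icc (-1) 1))
    (hf : ∀ x ∈ Icc (-1:ℝ) 1, HasDerivAt f (v x * g x) x) :
    ∫ x in (-1:ℝ)..1, g x * v x = f 1 - f (-1) := by
  have hfd : ∀ x ∈ uIcc (-1:ℝ) 1, HasDerivAt f (g x * v x) x := by
    intro x hx
    rw [uIcc_of_le (by norm_num)] at hx
    simpa [mul_comm] using hf x hx
  exact integral_eq_sub_of_hasDerivAt hfd (intervalIntegrable_of_continuousOn_Icc (by fun_prop))

/-- The Cauchy-Schwarz inequality for a weighted integral. -/
lemma weighted_cauchy_schwarz (hvc : ContinuousOn v (Icc (-1) 1))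
    (hv : ∀ x ∈ Icc (-1:ℝ) 1, 0 < v x) {f g : ℝ → ℝ}
    (hf : ContinuousOn f (Icc (-1) 1)) (hg : ContinuousOn g (Icc (-1) 1)) :
    ∫ x in (-1:ℝ)..1, f x * g x * v x ≤
      √(∫ x in (-1:ℝ)..1, f x ^ 2 * v x) * √(∫ x in (-1:ℝ)..1, g x ^ 2 * v x) := by
  set A := ∫ x in (-1:ℝ)..1, f x ^ 2 * v x with hA
  set B := ∫ x in (-1:ℝ)..1, f x * g x * v x with hB
  set C := ∫ x in (-1:ℝ)..1, g x ^ 2 * v x with hC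
  have hA0 : 0 ≤ A := weighted_integral_nonneg hv fun x _ => sq_nonneg _
  have key : ∀ r : ℝ, 0 ≤ A * (r * r) + 2 * B * r + C := by
    intro r
    have h0 : 0 ≤ ∫ x in (-1:ℝ)..1, (r * f x + g x) ^ 2 * v x :=
      weighted_integral_nonneg hv fun x _ => sq_nonneg _
    have h1 : ∫ x in (-1:ℝ)..1, (r * f x + g x) ^ 2 * v x
        = A * (r * r) + 2 * B * r + C := by
      have : ∀ x, (r * f x + g x) ^ 2 * v x
          = (r * r) * (f x ^ 2 * v x) + (2 * r) * (f x * g x * v x) + g x ^ 2 * v x := by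
        intro x; ring
      simp_rw [this]
      rw [intervalIntegral.integral_add, intervalIntegral.integral_add,
        intervalIntegral.integral_const_mul, intervalIntegral.integral_const_mul]
      · rw [← hA, ← hB, ← hC]; ring
      all_goals exact intervalIntegrable_of_continuousOn_Icc (by fun_prop)
    linarith
  have hd := discrim_le_zero key
  rw [← Real.sqrt_mul hA0]
  apply Real.le_sqrt_of_sq_le
  unfold discrim at hd
  nlinarith

lemma weighted_integral_mul_mul_le (hvc : ContinuousOn v (Icc (-1) 1))
    (hv : ∀ x ∈ Icc (-1:ℝ) 1, 0 < v x) {h f g : ℝ → ℝ} {M : ℝ}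
    (hh : ContinuousOn h (Icc (-1) 1))
    (hf : ContinuousOn f (Icc (-1) 1)) (hg : ContinuousOn g (Icc (-1) 1))
    (hM : ∀ x ∈ Icc (-1:ℝ) 1, |h x| ≤ M) :
    ∫ x in (-1:ℝ)..1, h x * f x * g x * v x ≤
      M * (√(∫ x in (-1:ℝ)..1, f x ^ 2 * v x) * √(∫ x in (-1:ℝ)..1, g x ^ 2 * v x)) := by
  have h1 : ∫ x in (-1:ℝ)..1, h x * f x * g x * v x
      ≤ ∫ x in (-1:ℝ)..1, M * (|f x| * |g x| * v x) := by
    apply intervalIntegral.integral_mono_on (by norm_num)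
      (intervalIntegrable_of_continuousOn_Icc (by fun_prop))
      (intervalIntegrable_of_continuousOn_Icc (by fun_prop))
    intro x hx
    have h2 : h x * f x * g x ≤ M * (|f x| * |g x|) := by
      calc h x * f x * g x ≤ |h x * f x * g x| := le_abs_self _
        _ = |h x| * (|f x| * |g x|) := by rw [abs_mul, abs_mul, mul_assoc]
        _ ≤ _ := by gcongr; exact hM x hx
    calc _ ≤ M * (|f x| * |g x|) * v x := by gcongr; exact (hv x hx).le
      _ = _ := by ring
  have hM0 : 0 ≤ M := (abs_nonneg _).trans (hM 0 (by norm_num))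
  rw [intervalIntegral.integral_const_mul] at h1
  refine h1.trans (mul_le_mul_of_nonneg_left ?_ hM0)
  simpa using weighted_cauchy_schwarz hvc hv hf.abs hg.abs

/-- If `f` vanishes somewhere, then `f² ≤ 2 ‖f‖₂ ‖∂ₛ f‖₂`. -/
lemma sq_le_two_mul_of_exists_zero (hvc : ContinuousOn v (Icc (-1) 1))
    (hv : ∀ x ∈ Icc (-1:ℝ) 1, 0 < v x) {f g : ℝ → ℝ}
    (hg : ContinuousOn g (Icc (-1) 1))
    (hf : ∀ x ∈ Icc (-1:ℝ) 1, HasDerivAt f (v x * g x) x)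
    (hz : ∃ z ∈ Icc (-1:ℝ) 1, f z = 0) {x : ℝ} (hx : x ∈ Icc (-1:ℝ) 1) :
    f x ^ 2 ≤ 2 * (√(∫ x in (-1:ℝ)..1, f x ^ 2 * v x) * √(∫ x in (-1:ℝ)..1, g x ^ 2 * v x)) := by
  obtain ⟨z, hz, hz0⟩ := hz
  have hfc : ContinuousOn f (Icc (-1) 1) := fun y hy => (hf y hy).continuousAt.continuousWithinAt
  have hsub : uIcc z x ⊆ Icc (-1) 1 := uIcc_subset_Icc hz hx
  have hd : ∀ y ∈ uIcc z x, HasDerivAt (fun y => f y ^ 2) (2 * (f y * g y * v y)) y := by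
    intro y hy
    exact ((hf y (hsub hy)).pow 2).congr_deriv (by push_cast; ring)
  have hi : IntervalIntegrable (fun y => 2 * (f y * g y * v y)) volume z x := by
    apply ContinuousOn.intervalIntegrable
    apply ContinuousOn.mono _ hsub
    fun_prop
  have h1 := integral_eq_sub_of_hasDerivAt hd hi
  rw [hz0] at h1
  have h2 : f x ^ 2 = |∫ y in z..x, 2 * (f y * g y * v y)| := by
    rw [h1]; rw [abs_of_nonneg] <;> nlinarith [sq_nonneg (f x)]
  rw [h2]
  have habs : IntervalIntegrable (fun y => |2 * (f y * g y * v y)|) volume (-1) 1 :=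
    intervalIntegrable_of_continuousOn_Icc (by fun_prop)
  calc |∫ y in z..x, 2 * (f y * g y * v y)|
      ≤ |∫ y in z..x, (|2 * (f y * g y * v y)|)| := by
        simpa [Real.norm_eq_abs] using norm_integral_le_abs_integral_norm
          (f := fun y => 2 * (f y * g y * v y)) (a := z) (b := x)
    _ ≤ |∫ y in (-1:ℝ)..1, (|2 * (f y * g y * v y)|)| := by
        apply abs_integral_mono_interval _ _ habs
        · rw [uIoc_of_le (show (-1:ℝ) ≤ 1 by norm_num), uIoc]
          exact Ioc_subset_Ioc (le_min hz.1 hx.1) (max_le hz.2 hx.2)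
        · exact Filter.Eventually.of_forall fun y => abs_nonneg _
    _ = ∫ y in (-1:ℝ)..1, 2 * (|f y| * |g y| * v y) := by
        rw [abs_of_nonneg (intervalIntegral.integral_nonneg (by norm_num) fun _ _ => abs_nonneg _)]
        apply intervalIntegral.integral_congr
        intro y hy
        rw [uIcc_of_le (by norm_num)] at hy
        simp [abs_mul, abs_of_pos (hv y hy)]
    _ ≤ _ := by
        rw [intervalIntegral.integral_const_mul]
        have := weighted_cauchy_schwarz hvc hv hfc.abs hg.abs
        simp only [sq_abs] at this
        linarith

/-- A Poincaré inequality for functions vanishing at both end points. -/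
lemma poincare_of_zero_boundary (hvc : ContinuousOn v (Icc (-1) 1))
    (hv : ∀ x ∈ Icc (-1:ℝ) 1, 0 < v x) {f g σ : ℝ → ℝ}
    (hσ : ∀ x ∈ Icc (-1:ℝ) 1, HasDerivAt σ (v x) x)
    (hg : ContinuousOn g (Icc (-1) 1))
    (hf : ∀ x ∈ Icc (-1:ℝ) 1, HasDerivAt f (v x * g x) x)
    (h0 : f (-1) = 0) (h1 : f 1 = 0) :
    √(∫ x in (-1:ℝ)..1, f x ^ 2 * v x) ≤
      (∫ x in (-1:ℝ)..1, v x) / 3 * √(∫ x in (-1:ℝ)..1, g x ^ 2 * v x) := by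
  set L := ∫ x in (-1:ℝ)..1, v x with hL
  have hLpos : 0 < L := intervalIntegral.intervalIntegral_pos_of_pos_on
    (intervalIntegrable_of_continuousOn_Icc hvc) (fun x hx => hv x (Ioo_subset_Icc_self hx))
    (by norm_num)
  have hfc : ContinuousOn f (Icc (-1) 1) := fun y hy => (hf y hy).continuousAt.continuousWithinAt
  have hσc : ContinuousOn σ (Icc (-1) 1) := fun y hy => (hσ y hy).continuousAt.continuousWithinAt
  have hmono : MonotoneOn σ (Icc (-1) 1) := by
    apply monotoneOn_of_deriv_nonneg (convex_Icc _ _) hσc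
    · intro x hx
      rw [interior_Icc] at hx
      exact (hσ x (Ioo_subset_Icc_self hx)).differentiableAt.differentiableWithinAt
    · intro x hx
      rw [interior_Icc] at hx
      rw [(hσ x (Ioo_subset_Icc_self hx)).deriv]
      exact (hv x (Ioo_subset_Icc_self hx)).le
  have hσL : σ 1 - σ (-1) = L := by
    rw [hL]
    symm
    apply integral_eq_sub_of_hasDerivAt
    · intro x hx
      rw [uIcc_of_le (by norm_num)] at hx
      exact hσ x hx
    · exact intervalIntegrable_of_continuousOn_Icc hvc
  set m := (σ 1 + σ (-1)) / 2 with hm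
  set A := 3 / L with hA
  have hcos : ∀ x ∈ Icc (-1:ℝ) 1, 0 < cos (A * (σ x - m)) := by
    intro x hx
    have e1 : σ (-1) ≤ σ x := hmono (by norm_num) hx hx.1
    have e2 : σ x ≤ σ 1 := hmono hx (by norm_num) hx.2
    have hAL : A * (L / 2) = 3 / 2 := by rw [hA]; field_simp
    have hA0 : 0 < A := by positivity
    have hpi := Real.pi_gt_three
    apply Real.cos_pos_of_mem_Ioo
    constructor
    · have : A * (-(L / 2)) ≤ A * (σ x - m) := by gcongr; rw [hm]; linarith
      linarith
    · have : A * (σ x - m) ≤ A * (L / 2) := by gcongr; rw [hm]; linarith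
      linarith
  have hw : ∀ x ∈ Icc (-1:ℝ) 1, HasDerivAt (fun x => A * tan (A * (σ x - m)))
      (v x * (A ^ 2 * (1 + tan (A * (σ x - m)) ^ 2))) x := by
    intro x hx
    have hc := (hcos x hx).ne'
    have := ((Real.hasDerivAt_tan hc).comp x (((hσ x hx).sub_const m).const_mul A)).const_mul A
    refine this.congr_deriv ?_
    rw [Real.tan_eq_sin_div_cos]
    field_simp
    rw [Real.cos_sq_add_sin_sq, mul_one]
  set w : ℝ → ℝ := fun x => tan (A * (σ x - m)) with hwdef
  have hwc : ContinuousOn w (Icc (-1) 1) := by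
    intro x hx
    have hc := (hcos x hx).ne'
    exact ((Real.hasDerivAt_tan hc).comp x
      (((hσ x hx).sub_const m).const_mul A)).continuousAt.continuousWithinAt
  have hint : ∫ x in (-1:ℝ)..1,
      (A ^ 2 * (1 + w x ^ 2) * f x ^ 2 + A * w x * (2 * f x * g x)) * v x = 0 := by
    rw [weighted_integral_deriv (f := fun x => A * w x * f x ^ 2) hvc (by fun_prop)]
    · simp [h0, h1]
    · intro x hx
      refine ((hw x hx).mul ((hf x hx).pow 2)).congr_deriv ?_
      simp only [hwdef, Pi.pow_apply]
      push_cast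
      ring
  have hnn : 0 ≤ ∫ x in (-1:ℝ)..1, (g x + A * w x * f x) ^ 2 * v x :=
    weighted_integral_nonneg hv fun x _ => sq_nonneg _
  have hexp : ∫ x in (-1:ℝ)..1, (g x + A * w x * f x) ^ 2 * v x
      = (∫ x in (-1:ℝ)..1, g x ^ 2 * v x) - A ^ 2 * (∫ x in (-1:ℝ)..1, f x ^ 2 * v x)
        + ∫ x in (-1:ℝ)..1,
          (A ^ 2 * (1 + w x ^ 2) * f x ^ 2 + A * w x * (2 * f x * g x)) * v x := by
    rw [← intervalIntegral.integral_const_mul, ← intervalIntegral.integral_sub,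
      ← intervalIntegral.integral_add]
    · congr 1; ext x; ring
    all_goals exact intervalIntegrable_of_continuousOn_Icc (by fun_prop)
  rw [hint] at hexp
  have hle : A ^ 2 * (∫ x in (-1:ℝ)..1, f x ^ 2 * v x) ≤ ∫ x in (-1:ℝ)..1, g x ^ 2 * v x := by
    linarith
  have hle2 : (∫ x in (-1:ℝ)..1, f x ^ 2 * v x)
      ≤ (L / 3) ^ 2 * ∫ x in (-1:ℝ)..1, g x ^ 2 * v x := by
    have : (∫ x in (-1:ℝ)..1, f x ^ 2 * v x)
        = (L / 3) ^ 2 * (A ^ 2 * ∫ x in (-1:ℝ)..1, f x ^ 2 * v x) := by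
      rw [hA]; field_simp
    rw [this]
    gcongr
  calc _ ≤ √((L / 3) ^ 2 * ∫ x in (-1:ℝ)..1, g x ^ 2 * v x) := Real.sqrt_le_sqrt hle2
    _ = _ := by rw [Real.sqrt_mul (by positivity), Real.sqrt_sq (by positivity)]

/-- If `f` vanishes at both end points, then `‖∂ₛ f‖₂² ≤ ‖f‖₂ ‖∂ₛ² f‖₂`. -/
lemma sq_norm_deriv_le (hvc : ContinuousOn v (Icc (-1) 1))
    (hv : ∀ x ∈ Icc (-1:ℝ) 1, 0 < v x) {f g h : ℝ → ℝ}
    (hh : ContinuousOn h (Icc (-1) 1))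
    (hf : ∀ x ∈ Icc (-1:ℝ) 1, HasDerivAt f (v x * g x) x)
    (hg : ∀ x ∈ Icc (-1:ℝ) 1, HasDerivAt g (v x * h x) x)
    (h0 : f (-1) = 0) (h1 : f 1 = 0) :
    √(∫ x in (-1:ℝ)..1, g x ^ 2 * v x) ^ 2 ≤
      √(∫ x in (-1:ℝ)..1, f x ^ 2 * v x) * √(∫ x in (-1:ℝ)..1, h x ^ 2 * v x) := by
  have hfc : ContinuousOn f (Icc (-1) 1) := fun y hy => (hf y hy).continuousAt.continuousWithinAt
  have hgc : ContinuousOn g (Icc (-1) 1) := fun y hy => (hg y hy).continuousAt.continuousWithinAt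
  rw [Real.sq_sqrt (weighted_integral_nonneg hv fun x _ => sq_nonneg _)]
  have hint : ∫ x in (-1:ℝ)..1, (g x ^ 2 + f x * h x) * v x = 0 := by
    rw [weighted_integral_deriv (f := fun x => f x * g x) hvc (by fun_prop)]
    · simp [h0, h1]
    · intro x hx
      exact ((hf x hx).mul (hg x hx)).congr_deriv (by ring)
  have hs : ∫ x in (-1:ℝ)..1, g x ^ 2 * v x
      = (∫ x in (-1:ℝ)..1, (g x ^ 2 + f x * h x) * v x)
        + ∫ x in (-1:ℝ)..1, (-f x) * h x * v x := by
    rw [← intervalIntegral.integral_add]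
    · congr 1; ext x; ring
    all_goals exact intervalIntegrable_of_continuousOn_Icc (by fun_prop)
  rw [hs, hint, zero_add]
  simpa using weighted_cauchy_schwarz hvc hv hfc.neg hh

/-- A Poincaré inequality for derivatives of functions vanishing at both end points. -/
lemma poincare_deriv_of_zero_boundary (hvc : ContinuousOn v (Icc (-1) 1))
    (hv : ∀ x ∈ Icc (-1:ℝ) 1, 0 < v x) {f g h σ : ℝ → ℝ}
    (hσ : ∀ x ∈ Icc (-1:ℝ) 1, HasDerivAt σ (v x) x)
    (hh : ContinuousOn h (Icc (-1) 1))
    (hf : ∀ x ∈ Icc (-1:ℝ) 1, HasDerivAt f (v x * g x) x)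
    (hg : ∀ x ∈ Icc (-1:ℝ) 1, HasDerivAt g (v x * h x) x)
    (h0 : f (-1) = 0) (h1 : f 1 = 0) :
    √(∫ x in (-1:ℝ)..1, g x ^ 2 * v x) ≤
      (∫ x in (-1:ℝ)..1, v x) / 3 * √(∫ x in (-1:ℝ)..1, h x ^ 2 * v x) := by
  have hgc : ContinuousOn g (Icc (-1) 1) := fun y hy => (hg y hy).continuousAt.continuousWithinAt
  have e1 := sq_norm_deriv_le hvc hv hh hf hg h0 h1
  have e2 := poincare_of_zero_boundary hvc hv hσ hgc hf h0 h1
  have hL : 0 ≤ ∫ x in (-1:ℝ)..1, v x :=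
    intervalIntegral.integral_nonneg (by norm_num) fun x hx => (hv x hx).le
  set a := √(∫ x in (-1:ℝ)..1, f x ^ 2 * v x)
  set b := √(∫ x in (-1:ℝ)..1, g x ^ 2 * v x)
  set c := √(∫ x in (-1:ℝ)..1, h x ^ 2 * v x)
  have hb : 0 ≤ b := Real.sqrt_nonneg _
  have hc : 0 ≤ c := Real.sqrt_nonneg _
  rcases hb.eq_or_lt with hb0 | hb0
  · rw [← hb0]; positivity
  · have : b * b ≤ b * ((∫ x in (-1:ℝ)..1, v x) / 3 * c) := by
      calc b * b = b ^ 2 := by ring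
        _ ≤ a * c := e1
        _ ≤ ((∫ x in (-1:ℝ)..1, v x) / 3 * b) * c := by gcongr
        _ = _ := by ring
    exact le_of_mul_le_mul_left this hb0

lemma exists_zero_of_deriv (hv : ∀ x ∈ Icc (-1:ℝ) 1, 0 < v x) {f g : ℝ → ℝ}
    (hf : ∀ x ∈ Icc (-1:ℝ) 1, HasDerivAt f (v x * g x) x)
    (h0 : f (-1) = 0) (h1 : f 1 = 0) : ∃ z ∈ Icc (-1:ℝ) 1, g z = 0 := by
  obtain ⟨z, hz, hz0⟩ := exists_hasDerivAt_eq_zero (f := f) (f' := fun x => v x * g x)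
    (show (-1:ℝ) < 1 by norm_num)
    (fun y hy => (hf y hy).continuousAt.continuousWithinAt) (h0.trans h1.symm)
    (fun x hx => hf x (Ioo_subset_Icc_self hx))
  exact ⟨z, Ioo_subset_Icc_self hz,
    (mul_eq_zero.mp hz0).resolve_left (hv z (Ioo_subset_Icc_self hz)).ne'⟩

end WeightedCalculus

section CurvatureEstimates

variable {v : ℝ → ℝ}

lemma weighted_integral_add_mul_mul_le (hvc : ContinuousOn v (Icc (-1) 1))
    (hv : ∀ x ∈ Icc (-1:ℝ) 1, 0 < v x) {F h f g : ℝ → ℝ} {A M B : ℝ}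
    (hh : ContinuousOn h (Icc (-1) 1))
    (hf : ContinuousOn f (Icc (-1) 1)) (hg : ContinuousOn g (Icc (-1) 1))
    (hM : ∀ x ∈ Icc (-1:ℝ) 1, |h x| ≤ M)
    (hB : M * (√(∫ x in (-1:ℝ)..1, f x ^ 2 * v x) * √(∫ x in (-1:ℝ)..1, g x ^ 2 * v x)) ≤ B)
    (hF : ContinuousOn F (Icc (-1) 1) ∧ ∫ x in (-1:ℝ)..1, F x * v x ≤ A) :
    ContinuousOn (fun x => F x + h x * f x * g x) (Icc (-1) 1) ∧
      ∫ x in (-1:ℝ)..1, (F x + h x * f x * g x) * v x ≤ A + B := by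
  obtain ⟨hFc, hF⟩ := hF
  refine ⟨by fun_prop, ?_⟩
  have e : ∫ x in (-1:ℝ)..1, (F x + h x * f x * g x) * v x
      = (∫ x in (-1:ℝ)..1, F x * v x) + ∫ x in (-1:ℝ)..1, h x * f x * g x * v x := by
    rw [← intervalIntegral.integral_add]
    · congr 1; ext x; ring
    all_goals exact intervalIntegrable_of_continuousOn_Icc (by fun_prop)
  rw [e]
  exact add_le_add hF ((weighted_integral_mul_mul_le hvc hv hh hf hg hM).trans hB)

/-- The integrand of `d/dt ‖k_{ss}‖₂²` after integration by parts, as a function of the arc length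
derivatives `k j` of the curvature. -/
def evolutionIntegrand (k : ℕ → ℝ → ℝ) (x : ℝ) : ℝ :=
  -2 * k 5 x * (k 5 x + k 0 x * k 1 x * k 2 x + k 0 x ^ 2 * k 3 x - 1 / 2 * k 1 x ^ 3)
    + (k 4 x + k 0 x ^ 2 * k 2 x - 1 / 2 * k 0 x * k 1 x ^ 2)
      * (2 * k 0 x ^ 2 * k 4 x - 2 * k 0 x * k 1 x * k 3 x + k 0 x * k 2 x ^ 2)

lemma integral_evolutionIntegrand_le_of_bounds (hvc : ContinuousOn v (Icc (-1) 1))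
    (hv : ∀ x ∈ Icc (-1:ℝ) 1, 0 < v x) {k : ℕ → ℝ → ℝ} {N : ℕ → ℝ} {C : ℝ} (hC : 0 ≤ C)
    (hk : ∀ j, ContinuousOn (k j) (Icc (-1) 1))
    (hN : ∀ j, N j = √(∫ x in (-1:ℝ)..1, k j x ^ 2 * v x))
    (hsup : ∀ j ≤ 4, ∀ x ∈ Icc (-1:ℝ) 1, k j x ^ 2 ≤ 2 * C * N (j + 1) ^ 2)
    (h2 : N 2 ≤ C * N 3) (h3 : N 3 ≤ C * N 4) (h4 : N 4 ≤ C * N 5)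
    (h13 : N 2 ^ 2 ≤ N 1 * N 3) :
    ∫ x in (-1:ℝ)..1, evolutionIntegrand k x * v x
      ≤ -2 * N 5 ^ 2 + 20 * C ^ 3 * N 1 ^ 2 * N 5 ^ 2 + 30 * C ^ 6 * N 1 ^ 4 * N 5 ^ 2 := by
  have N0 : ∀ j, 0 ≤ N j := fun j => (hN j) ▸ Real.sqrt_nonneg _
  have hn1 := N0 1
  have hn2 := N0 2
  have hn3 := N0 3
  have hn4 := N0 4
  have hn5 := N0 5
  have b4 : N 4 ≤ C * N 5 := h4
  have b3 : N 3 ≤ C ^ 2 * N 5 := by nlinarith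
  have b2 : N 2 ≤ C ^ 3 * N 5 := by
    calc N 2 ≤ C * N 3 := h2
      _ ≤ C * (C ^ 2 * N 5) := by gcongr
      _ = _ := by ring
  have pair : ∀ i j, i ≤ 4 → j ≤ 4 → ∀ x ∈ Icc (-1:ℝ) 1,
      |k i x * k j x| ≤ 2 * C * N (i + 1) * N (j + 1) := by
    intro i j hi hj x hx
    have hnn : 0 ≤ 2 * C * N (i + 1) * N (j + 1) :=
      mul_nonneg (mul_nonneg (by positivity) (N0 _)) (N0 _)
    apply abs_le_of_sq_le_sq _ hnn
    calc (k i x * k j x) ^ 2 = k i x ^ 2 * k j x ^ 2 := by ring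
      _ ≤ (2 * C * N (i + 1) ^ 2) * (2 * C * N (j + 1) ^ 2) := by
          gcongr
          · exact hsup i hi x hx
          · exact hsup j hj x hx
      _ = _ := by ring
  have scale : ∀ {c d p M : ℝ}, |c| = d → |p| ≤ M → |c * p| ≤ d * M := by
    intro c d p M hc hp
    rw [abs_mul, hc]
    exact mul_le_mul_of_nonneg_left hp (hc ▸ abs_nonneg c)
  have prod : ∀ {p q M M' : ℝ}, |p| ≤ M → |q| ≤ M' → |p * q| ≤ M * M' := by
    intro p q M M' hp hq
    rw [abs_mul]
    exact mul_le_mul hp hq (abs_nonneg _) ((abs_nonneg _).trans hp)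
  have base : ContinuousOn (fun x => -2 * k 5 x ^ 2) (Icc (-1) 1) ∧
      ∫ x in (-1:ℝ)..1, (-2 * k 5 x ^ 2) * v x ≤ -2 * N 5 ^ 2 := by
    have := hk 5
    refine ⟨by fun_prop, ?_⟩
    rw [hN, Real.sq_sqrt (weighted_integral_nonneg hv fun x _ => sq_nonneg _),
      ← intervalIntegral.integral_const_mul]
    simp only [mul_assoc, le_refl]
  have c0 := hk 0
  have c1 := hk 1
  have c2 := hk 2
  have c3 := hk 3
  have c4 := hk 4
  have t1 := weighted_integral_add_mul_mul_le hvc hv (h := fun x => -2 * (k 0 x * k 2 x))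
    (M := 2 * (2 * C * N 1 * N 3)) (B := 4 * C ^ 3 * N 1 ^ 2 * N 5 ^ 2)
    (by fun_prop) (hk 1) (hk 5)
    (fun x hx => scale (by norm_num) (pair 0 2 (by norm_num) (by norm_num) x hx))
    (by
      simp only [← hN]
      calc _ ≤ 2 * (2 * C * N 1 * (C ^ 2 * N 5)) * (N 1 * N 5) := by gcongr
        _ = _ := by ring)
    base
  have t2 := weighted_integral_add_mul_mul_le hvc hv (h := fun x => -2 * (k 0 x * k 0 x))
    (M := 2 * (2 * C * N 1 * N 1)) (B := 4 * C ^ 3 * N 1 ^ 2 * N 5 ^ 2)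
    (by fun_prop) (hk 3) (hk 5)
    (fun x hx => scale (by norm_num) (pair 0 0 (by norm_num) (by norm_num) x hx))
    (by
      simp only [← hN]
      calc _ ≤ 2 * (2 * C * N 1 * N 1) * (C ^ 2 * N 5 * N 5) := by gcongr
        _ = _ := by ring)
    t1
  have t3 := weighted_integral_add_mul_mul_le hvc hv (h := fun x => k 1 x * k 1 x)
    (M := 2 * C * N 2 * N 2) (B := 2 * C ^ 3 * N 1 ^ 2 * N 5 ^ 2)
    (by fun_prop) (hk 1) (hk 5)
    (fun x hx => pair 1 1 (by norm_num) (by norm_num) x hx)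
    (by
      simp only [← hN]
      calc _ = 2 * C * N 2 ^ 2 * (N 1 * N 5) := by ring
        _ ≤ 2 * C * (N 1 * N 3) * (N 1 * N 5) := by gcongr
        _ ≤ 2 * C * (N 1 * (C ^ 2 * N 5)) * (N 1 * N 5) := by gcongr
        _ = _ := by ring)
    t2
  have t4 := weighted_integral_add_mul_mul_le hvc hv (h := fun x => 2 * (k 0 x * k 0 x))
    (M := 2 * (2 * C * N 1 * N 1)) (B := 4 * C ^ 3 * N 1 ^ 2 * N 5 ^ 2)
    (by fun_prop) (hk 4) (hk 4)
    (fun x hx => scale (by norm_num) (pair 0 0 (by norm_num) (by norm_num) x hx))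
    (by
      simp only [← hN]
      calc _ ≤ 2 * (2 * C * N 1 * N 1) * ((C * N 5) * (C * N 5)) := by gcongr
        _ = _ := by ring)
    t3
  have t5 := weighted_integral_add_mul_mul_le hvc hv (h := fun x => -2 * (k 0 x * k 3 x))
    (M := 2 * (2 * C * N 1 * N 4)) (B := 4 * C ^ 3 * N 1 ^ 2 * N 5 ^ 2)
    (by fun_prop) (hk 1) (hk 4)
    (fun x hx => scale (by norm_num) (pair 0 3 (by norm_num) (by norm_num) x hx))
    (by
      simp only [← hN]
      calc _ ≤ 2 * (2 * C * N 1 * (C * N 5)) * (N 1 * (C * N 5)) := by gcongr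
        _ = _ := by ring)
    t4
  have t6 := weighted_integral_add_mul_mul_le hvc hv (h := fun x => k 0 x * k 4 x)
    (M := 2 * C * N 1 * N 5) (B := 2 * C ^ 3 * N 1 ^ 2 * N 5 ^ 2)
    (by fun_prop) (hk 2) (hk 2)
    (fun x hx => pair 0 4 (by norm_num) (by norm_num) x hx)
    (by
      simp only [← hN]
      calc _ = 2 * C * N 1 * N 5 * N 2 ^ 2 := by ring
        _ ≤ 2 * C * N 1 * N 5 * (N 1 * N 3) := by gcongr
        _ ≤ 2 * C * N 1 * N 5 * (N 1 * (C ^ 2 * N 5)) := by gcongr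
        _ = _ := by ring)
    t5
  have t7 := weighted_integral_add_mul_mul_le hvc hv
    (h := fun x => 2 * ((k 0 x * k 0 x) * (k 0 x * k 0 x)))
    (M := 2 * ((2 * C * N 1 * N 1) * (2 * C * N 1 * N 1))) (B := 8 * C ^ 6 * N 1 ^ 4 * N 5 ^ 2)
    (by fun_prop) (hk 2) (hk 4)
    (fun x hx => scale (by norm_num) (prod (pair 0 0 (by norm_num) (by norm_num) x hx)
      (pair 0 0 (by norm_num) (by norm_num) x hx)))
    (by
      simp only [← hN]
      calc _ ≤ 2 * ((2 * C * N 1 * N 1) * (2 * C * N 1 * N 1)) * ((C ^ 3 * N 5) * (C * N 5)) := by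
            gcongr
        _ = _ := by ring)
    t6
  have t8 := weighted_integral_add_mul_mul_le hvc hv
    (h := fun x => -2 * ((k 0 x * k 0 x) * (k 0 x * k 2 x)))
    (M := 2 * ((2 * C * N 1 * N 1) * (2 * C * N 1 * N 3))) (B := 8 * C ^ 6 * N 1 ^ 4 * N 5 ^ 2)
    (by fun_prop) (hk 1) (hk 3)
    (fun x hx => scale (by norm_num) (prod (pair 0 0 (by norm_num) (by norm_num) x hx)
      (pair 0 2 (by norm_num) (by norm_num) x hx)))
    (by
      simp only [← hN]
      calc _ ≤ 2 * ((2 * C * N 1 * N 1) * (2 * C * N 1 * (C ^ 2 * N 5)))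
            * (N 1 * (C ^ 2 * N 5)) := by
            gcongr
        _ = _ := by ring)
    t7
  have t9 := weighted_integral_add_mul_mul_le hvc hv
    (h := fun x => (k 0 x * k 0 x) * (k 0 x * k 2 x))
    (M := (2 * C * N 1 * N 1) * (2 * C * N 1 * N 3)) (B := 4 * C ^ 6 * N 1 ^ 4 * N 5 ^ 2)
    (by fun_prop) (hk 2) (hk 2)
    (fun x hx => prod (pair 0 0 (by norm_num) (by norm_num) x hx)
      (pair 0 2 (by norm_num) (by norm_num) x hx))
    (by
      simp only [← hN]
      calc _ = (2 * C * N 1 * N 1) * (2 * C * N 1 * N 3) * N 2 ^ 2 := by ring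
        _ ≤ (2 * C * N 1 * N 1) * (2 * C * N 1 * N 3) * (N 1 * N 3) := by gcongr
        _ ≤ (2 * C * N 1 * N 1) * (2 * C * N 1 * (C ^ 2 * N 5)) * (N 1 * (C ^ 2 * N 5)) := by
            gcongr
        _ = _ := by ring)
    t8
  have t10 := weighted_integral_add_mul_mul_le hvc hv
    (h := fun x => -((k 0 x * k 0 x) * (k 0 x * k 1 x)))
    (M := (2 * C * N 1 * N 1) * (2 * C * N 1 * N 2)) (B := 4 * C ^ 6 * N 1 ^ 4 * N 5 ^ 2)
    (by fun_prop) (hk 1) (hk 4)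
    (fun x hx => (abs_neg _).trans_le (prod (pair 0 0 (by norm_num) (by norm_num) x hx)
      (pair 0 1 (by norm_num) (by norm_num) x hx)))
    (by
      simp only [← hN]
      calc _ ≤ (2 * C * N 1 * N 1) * (2 * C * N 1 * (C ^ 3 * N 5)) * (N 1 * (C * N 5)) := by
            gcongr
        _ = _ := by ring)
    t9
  have t11 := weighted_integral_add_mul_mul_le hvc hv
    (h := fun x => (k 0 x * k 0 x) * (k 1 x * k 1 x))
    (M := (2 * C * N 1 * N 1) * (2 * C * N 2 * N 2)) (B := 4 * C ^ 6 * N 1 ^ 4 * N 5 ^ 2)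
    (by fun_prop) (hk 1) (hk 3)
    (fun x hx => prod (pair 0 0 (by norm_num) (by norm_num) x hx)
      (pair 1 1 (by norm_num) (by norm_num) x hx))
    (by
      simp only [← hN]
      calc _ = (2 * C * N 1 * N 1) * (2 * C * N 2 ^ 2) * (N 1 * N 3) := by ring
        _ ≤ (2 * C * N 1 * N 1) * (2 * C * (N 1 * N 3)) * (N 1 * N 3) := by gcongr
        _ ≤ (2 * C * N 1 * N 1) * (2 * C * (N 1 * (C ^ 2 * N 5))) * (N 1 * (C ^ 2 * N 5)) := by
            gcongr
        _ = _ := by ring)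
    t10
  have t12 := weighted_integral_add_mul_mul_le hvc hv
    (h := fun x => -(1 / 2 * ((k 0 x * k 0 x) * (k 2 x * k 2 x))))
    (M := 1 / 2 * ((2 * C * N 1 * N 1) * (2 * C * N 3 * N 3))) (B := 2 * C ^ 6 * N 1 ^ 4 * N 5 ^ 2)
    (by fun_prop) (hk 1) (hk 1)
    (fun x hx => (abs_neg _).trans_le (scale (by norm_num)
      (prod (pair 0 0 (by norm_num) (by norm_num) x hx)
      (pair 2 2 (by norm_num) (by norm_num) x hx))))
    (by
      simp only [← hN]
      calc _ ≤ 1 / 2 * ((2 * C * N 1 * N 1) * (2 * C * (C ^ 2 * N 5) * (C ^ 2 * N 5)))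
            * (N 1 * N 1) := by
            gcongr
        _ = _ := by ring)
    t11
  calc _ = _ := by
        apply intervalIntegral.integral_congr
        intro x _
        simp only [evolutionIntegrand]
        ring
    _ ≤ _ := t12.2
    _ = _ := by ring

lemma integral_evolutionIntegrand_le (hvc : ContinuousOn v (Icc (-1) 1))
    (hv : ∀ x ∈ Icc (-1:ℝ) 1, 0 < v x) {k : ℕ → ℝ → ℝ} {σ θ : ℝ → ℝ}
    (hσ : ∀ x ∈ Icc (-1:ℝ) 1, HasDerivAt σ (v x) x)
    (hθ : ∀ x ∈ Icc (-1:ℝ) 1, HasDerivAt θ (v x * k 0 x) x)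
    (hk : ∀ j, ∀ x ∈ Icc (-1:ℝ) 1, HasDerivAt (k j) (v x * k (j + 1) x) x)
    (hθ0 : θ (-1) = 0) (hθ1 : θ 1 = 0) (h10 : k 1 (-1) = 0) (h11 : k 1 1 = 0)
    (h30 : k 3 (-1) = 0) (h31 : k 3 1 = 0) :
    ∫ x in (-1:ℝ)..1, evolutionIntegrand k x * v x
      ≤ (-2 + 74 * (∫ x in (-1:ℝ)..1, v x) ^ 3 / π ^ 3 * (∫ x in (-1:ℝ)..1, k 1 x ^ 2 * v x)
          + 174 * (∫ x in (-1:ℝ)..1, v x) ^ 6 / π ^ 6 * (∫ x in (-1:ℝ)..1, k 1 x ^ 2 * v x) ^ 2)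
          * (∫ x in (-1:ℝ)..1, k 5 x ^ 2 * v x)
        - 3 / (∫ x in (-1:ℝ)..1, v x) * (∫ x in (-1:ℝ)..1, k 2 x ^ 2 * v x) ^ 2 := by
  have hkc : ∀ j, ContinuousOn (k j) (Icc (-1) 1) :=
    fun j y hy => (hk j y hy).continuousAt.continuousWithinAt
  set L := ∫ x in (-1:ℝ)..1, v x with hL
  have hLpos : 0 < L := intervalIntegral.intervalIntegral_pos_of_pos_on
    (intervalIntegrable_of_continuousOn_Icc hvc) (fun x hx => hv x (Ioo_subset_Icc_self hx))
    (by norm_num)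
  set N : ℕ → ℝ := fun j => √(∫ x in (-1:ℝ)..1, k j x ^ 2 * v x) with hN
  have N0 : ∀ j, 0 ≤ N j := fun j => Real.sqrt_nonneg _
  have hNsq : ∀ j, ∫ x in (-1:ℝ)..1, k j x ^ 2 * v x = N j ^ 2 := fun j =>
    (Real.sq_sqrt (weighted_integral_nonneg hv fun x _ => sq_nonneg _)).symm
  have p0 : N 0 ≤ L / 3 * N 1 :=
    poincare_deriv_of_zero_boundary hvc hv hσ (hkc 1) hθ (hk 0) hθ0 hθ1
  have p1 : N 1 ≤ L / 3 * N 2 := poincare_of_zero_boundary hvc hv hσ (hkc 2) (hk 1) h10 h11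
  have p2 : N 2 ≤ L / 3 * N 3 :=
    poincare_deriv_of_zero_boundary hvc hv hσ (hkc 3) (hk 1) (hk 2) h10 h11
  have p3 : N 3 ≤ L / 3 * N 4 := poincare_of_zero_boundary hvc hv hσ (hkc 4) (hk 3) h30 h31
  have p4 : N 4 ≤ L / 3 * N 5 :=
    poincare_deriv_of_zero_boundary hvc hv hσ (hkc 5) (hk 3) (hk 4) h30 h31
  have h13 : N 2 ^ 2 ≤ N 1 * N 3 := sq_norm_deriv_le hvc hv (hkc 3) (hk 1) (hk 2) h10 h11
  have sup_aux : ∀ j, (∃ z ∈ Icc (-1:ℝ) 1, k j z = 0) → N j ≤ L / 3 * N (j + 1) →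
      ∀ x ∈ Icc (-1:ℝ) 1, k j x ^ 2 ≤ 2 * (L / 3) * N (j + 1) ^ 2 := by
    intro j hz hp x hx
    have h := sq_le_two_mul_of_exists_zero hvc hv (hkc (j + 1)) (hk j) hz hx
    change k j x ^ 2 ≤ 2 * (N j * N (j + 1)) at h
    nlinarith [N0 (j + 1), N0 j]
  have hsup : ∀ j ≤ 4, ∀ x ∈ Icc (-1:ℝ) 1, k j x ^ 2 ≤ 2 * (L / 3) * N (j + 1) ^ 2 := by
    intro j hj
    interval_cases j
    · exact sup_aux 0 (exists_zero_of_deriv hv hθ hθ0 hθ1) p0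
    · exact sup_aux 1 ⟨1, by norm_num, h11⟩ p1
    · exact sup_aux 2 (exists_zero_of_deriv hv (hk 1) h10 h11) p2
    · exact sup_aux 3 ⟨1, by norm_num, h31⟩ p3
    · exact sup_aux 4 (exists_zero_of_deriv hv (hk 3) h30 h31) p4
  have main := integral_evolutionIntegrand_le_of_bounds hvc hv (C := L / 3) (by positivity) hkc
    (fun j => rfl) hsup p2 p3 p4 h13
  rw [hNsq 1, hNsq 2, hNsq 5]
  refine main.trans ?_
  have hπ := Real.pi_pos
  have n2 : N 2 ^ 4 ≤ N 1 ^ 2 * (L / 3) ^ 4 * N 5 ^ 2 := by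
    have n3 : N 3 ≤ (L / 3) ^ 2 * N 5 := by
      calc N 3 ≤ L / 3 * N 4 := p3
        _ ≤ L / 3 * (L / 3 * N 5) := by gcongr
        _ = _ := by ring
    calc N 2 ^ 4 = (N 2 ^ 2) ^ 2 := by ring
      _ ≤ (N 1 * N 3) ^ 2 := by gcongr
      _ ≤ (N 1 * ((L / 3) ^ 2 * N 5)) ^ 2 := by
          have := N0 1
          have := N0 3
          gcongr
      _ = _ := by ring
  have n2' : 3 / L * (N 2 ^ 2) ^ 2 ≤ (L / 3) ^ 3 * N 1 ^ 2 * N 5 ^ 2 := by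
    calc 3 / L * (N 2 ^ 2) ^ 2 = 3 / L * N 2 ^ 4 := by ring
      _ ≤ 3 / L * (N 1 ^ 2 * (L / 3) ^ 4 * N 5 ^ 2) := by gcongr
      _ = _ := by field_simp
  have hp4 := Real.pi_le_four
  have c3 : 21 * (L / 3) ^ 3 ≤ 74 * L ^ 3 / π ^ 3 := by
    rw [le_div_iff₀ (by positivity)]
    have : π ^ 3 ≤ 4 ^ 3 := by gcongr
    calc 21 * (L / 3) ^ 3 * π ^ 3 ≤ 21 * (L / 3) ^ 3 * 4 ^ 3 := by gcongr
      _ = (21 * 64 / 27) * L ^ 3 := by ring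
      _ ≤ 74 * L ^ 3 := by gcongr; norm_num
  have c6 : 30 * (L / 3) ^ 6 ≤ 174 * L ^ 6 / π ^ 6 := by
    rw [le_div_iff₀ (by positivity)]
    have : π ^ 6 ≤ 4 ^ 6 := by gcongr
    calc 30 * (L / 3) ^ 6 * π ^ 6 ≤ 30 * (L / 3) ^ 6 * 4 ^ 6 := by gcongr
      _ = (30 * 4096 / 729) * L ^ 6 := by ring
      _ ≤ 174 * L ^ 6 := by gcongr; norm_num
  have d3 : 21 * (L / 3) ^ 3 * (N 1 ^ 2 * N 5 ^ 2) ≤ 74 * L ^ 3 / π ^ 3 * (N 1 ^ 2 * N 5 ^ 2) := by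
    gcongr
  have d6 : 30 * (L / 3) ^ 6 * (N 1 ^ 4 * N 5 ^ 2) ≤ 174 * L ^ 6 / π ^ 6 * (N 1 ^ 4 * N 5 ^ 2) := by
    gcongr
  calc _ ≤ -2 * N 5 ^ 2 + 74 * L ^ 3 / π ^ 3 * (N 1 ^ 2 * N 5 ^ 2)
        + 174 * L ^ 6 / π ^ 6 * (N 1 ^ 4 * N 5 ^ 2) - 3 / L * (N 2 ^ 2) ^ 2 := by linarith
    _ = _ := by ring

end CurvatureEstimates

section MovingFrame

open scoped ContDiff

/-- The derivative of `f : ℝ × ℝ → ℝ` in the direction `w`. -/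
def pd (w : ℝ × ℝ) (f : ℝ × ℝ → ℝ) (p : ℝ × ℝ) : ℝ := fderiv ℝ f p w

/-- The arc length derivative `V⁻¹ ∂ₓ` of a function of `(t, x)`. -/
def sd (V f : ℝ × ℝ → ℝ) (p : ℝ × ℝ) : ℝ := (V p)⁻¹ * pd (0, 1) f p

/-- The iterated arc length derivative of a function of `(t, x)`. -/
def sdIter (V : ℝ × ℝ → ℝ) : ℕ → (ℝ × ℝ → ℝ) → (ℝ × ℝ → ℝ)
  | 0, f => f
  | n + 1, f => sd V (sdIter V n f)

/-- The curvature of a curve with unit tangent `(c, d)`. -/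
def frameCurv (V c d : ℝ × ℝ → ℝ) (p : ℝ × ℝ) : ℝ := c p * sd V d p - d p * sd V c p

variable {w : ℝ × ℝ} {p : ℝ × ℝ} {S : Set (ℝ × ℝ)} {f g : ℝ × ℝ → ℝ}

lemma pd_add (hf : DifferentiableAt ℝ f p) (hg : DifferentiableAt ℝ g p) :
    pd w (fun q => f q + g q) p = pd w f p + pd w g p := by
  simp [pd, fderiv_fun_add hf hg]

lemma pd_sub (hf : DifferentiableAt ℝ f p) (hg : DifferentiableAt ℝ g p) :
    pd w (fun q => f q - g q) p = pd w f p - pd w g p := by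
  simp [pd, fderiv_fun_sub hf hg]

lemma pd_neg : pd w (fun q => -f q) p = -pd w f p := by
  simp [pd, fderiv_fun_neg]

lemma pd_mul (hf : DifferentiableAt ℝ f p) (hg : DifferentiableAt ℝ g p) :
    pd w (fun q => f q * g q) p = pd w f p * g p + f p * pd w g p := by
  simp [pd, fderiv_fun_mul hf hg]; ring

lemma pd_const (a : ℝ) : pd w (fun _ => a) p = 0 := by
  simp [pd]

lemma pd_congr (hS : IsOpen S) (hp : p ∈ S) (h : ∀ q ∈ S, f q = g q) : pd w f p = pd w g p := by
  have : f =ᶠ[nhds p] g := Filter.eventuallyEq_of_mem (hS.mem_nhds hp) h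
  simp [pd, this.fderiv_eq]

lemma contDiffOn_pd (hS : IsOpen S) (hf : ContDiffOn ℝ ∞ f S) (w : ℝ × ℝ) :
    ContDiffOn ℝ ∞ (pd w f) S :=
  (hf.fderiv_of_isOpen hS (by simp)).clm_apply contDiffOn_const

lemma ContDiffOn.differentiableAt_of_isOpen (hf : ContDiffOn ℝ ∞ f S) (hS : IsOpen S)
    (hp : p ∈ S) : DifferentiableAt ℝ f p :=
  (hf.contDiffAt (hS.mem_nhds hp)).differentiableAt (by simp)

lemma pd_comm (hS : IsOpen S) (hf : ContDiffOn ℝ ∞ f S) (hp : p ∈ S) (w z : ℝ × ℝ) :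
    pd w (pd z f) p = pd z (pd w f) p := by
  have hd : DifferentiableAt ℝ (fderiv ℝ f) p :=
    ((hf.fderiv_of_isOpen (m := ∞) hS (by simp)).contDiffAt (hS.mem_nhds hp)).differentiableAt
      (by simp)
  have key : ∀ a b : ℝ × ℝ, pd a (pd b f) p = fderiv ℝ (fderiv ℝ f) p a b := by
    intro a b
    change fderiv ℝ (fun q => fderiv ℝ f q b) p a = _
    rw [fderiv_clm_apply hd (differentiableAt_const _)]
    simp
  rw [key, key]
  exact (hf.contDiffAt (hS.mem_nhds hp)).isSymmSndFDerivAt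
    (by simpa using WithTop.coe_le_coe.2 (le_top : (2 : ℕ∞) ≤ ⊤)) w z

lemma hasDerivAt_slice_snd {t x : ℝ} (hf : DifferentiableAt ℝ f (t, x)) :
    HasDerivAt (fun y => f (t, y)) (pd (0, 1) f (t, x)) x :=
  hf.hasFDerivAt.comp_hasDerivAt x ((hasDerivAt_const x t).prodMk (hasDerivAt_id x))

lemma hasDerivAt_slice_fst {t x : ℝ} (hf : DifferentiableAt ℝ f (t, x)) :
    HasDerivAt (fun u => f (u, x)) (pd (1, 0) f (t, x)) t :=
  HasFDerivAt.comp_hasDerivAt (f := fun u => (u, x)) t hf.hasFDerivAt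
    ((hasDerivAt_id t).prodMk (hasDerivAt_const t x))

variable {V c d F : ℝ × ℝ → ℝ}

lemma contDiffOn_sd (hS : IsOpen S) (hV : ContDiffOn ℝ ∞ V S) (hV0 : ∀ q ∈ S, 0 < V q)
    (hf : ContDiffOn ℝ ∞ f S) : ContDiffOn ℝ ∞ (sd V f) S :=
  (hV.inv fun q hq => (hV0 q hq).ne').mul (contDiffOn_pd hS hf _)

lemma contDiffOn_sdIter (hS : IsOpen S) (hV : ContDiffOn ℝ ∞ V S) (hV0 : ∀ q ∈ S, 0 < V q)
    (hf : ContDiffOn ℝ ∞ f S) (n : ℕ) : ContDiffOn ℝ ∞ (sdIter V n f) S := by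
  induction n with
  | zero => exact hf
  | succ n ih => exact contDiffOn_sd hS hV hV0 ih

lemma contDiffOn_frameCurv (hS : IsOpen S) (hV : ContDiffOn ℝ ∞ V S) (hV0 : ∀ q ∈ S, 0 < V q)
    (hc : ContDiffOn ℝ ∞ c S) (hd : ContDiffOn ℝ ∞ d S) : ContDiffOn ℝ ∞ (frameCurv V c d) S :=
  (hc.mul (contDiffOn_sd hS hV hV0 hd)).sub (hd.mul (contDiffOn_sd hS hV hV0 hc))

lemma pd_eq_mul_sd (hV0 : V p ≠ 0) : pd (0, 1) f p = V p * sd V f p := by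
  simp [sd, hV0]

/-- The Frenet equations. -/
lemma sd_frame (hS : IsOpen S) (hc : ContDiffOn ℝ ∞ c S) (hd : ContDiffOn ℝ ∞ d S)
    (hcd : ∀ q ∈ S, c q * c q + d q * d q = 1) (hp : p ∈ S) :
    sd V c p = -(frameCurv V c d p * d p) ∧ sd V d p = frameCurv V c d p * c p := by
  have hc' := hc.differentiableAt_of_isOpen hS hp
  have hd' := hd.differentiableAt_of_isOpen hS hp
  have h := pd_congr (w := (0, 1)) hS hp hcd
  rw [pd_const, pd_add (hc'.fun_mul hc') (hd'.fun_mul hd'), pd_mul hc' hc', pd_mul hd' hd'] at h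
  have h1 := hcd p hp
  have h2 : c p * sd V c p + d p * sd V d p = 0 := by
    simp only [sd]
    linear_combination (V p)⁻¹ / 2 * h
  simp only [frameCurv]
  constructor
  · linear_combination (-sd V c p) * h1 + c p * h2
  · linear_combination (-sd V d p) * h1 + d p * h2

/-- A smooth family of curves `(G, H)` over `S` with speed `V` and unit tangent `(c, d)`, moving
with normal speed `F`. -/
structure NormalMotion (S : Set (ℝ × ℝ)) (G H V c d F : ℝ × ℝ → ℝ) : Prop where
  isOpen : IsOpen S
  smoothG : ContDiffOn ℝ ∞ G S
  smoothH : ContDiffOn ℝ ∞ H S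
  smoothV : ContDiffOn ℝ ∞ V S
  smoothc : ContDiffOn ℝ ∞ c S
  smoothd : ContDiffOn ℝ ∞ d S
  smoothF : ContDiffOn ℝ ∞ F S
  pos : ∀ q ∈ S, 0 < V q
  unit : ∀ q ∈ S, c q * c q + d q * d q = 1
  pdx_fst : ∀ q ∈ S, pd (0, 1) G q = V q * c q
  pdx_snd : ∀ q ∈ S, pd (0, 1) H q = V q * d q
  pdt_fst : ∀ q ∈ S, pd (1, 0) G q = -(F q * d q)
  pdt_snd : ∀ q ∈ S, pd (1, 0) H q = F q * c q

namespace NormalMotion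

variable {G H : ℝ × ℝ → ℝ}

lemma evolution_frame (M : NormalMotion S G H V c d F) (hp : p ∈ S) :
    pd (1, 0) V p = -(frameCurv V c d p * F p * V p) ∧ pd (1, 0) c p = -(sd V F p * d p) ∧
      pd (1, 0) d p = sd V F p * c p := by
  have hS := M.isOpen
  have hV' := M.smoothV.differentiableAt_of_isOpen hS hp
  have hc' := M.smoothc.differentiableAt_of_isOpen hS hp
  have hd' := M.smoothd.differentiableAt_of_isOpen hS hp
  have hF' := M.smoothF.differentiableAt_of_isOpen hS hp
  have hV0 := (M.pos p hp).ne'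
  have hcd := M.unit p hp
  have e1 := pd_comm hS M.smoothG hp (1, 0) (0, 1)
  rw [pd_congr hS hp M.pdx_fst, pd_congr hS hp M.pdt_fst, pd_mul hV' hc', pd_neg, pd_mul hF' hd',
    pd_eq_mul_sd hV0, pd_eq_mul_sd hV0, (sd_frame hS M.smoothc M.smoothd M.unit hp).2] at e1
  have e2 := pd_comm hS M.smoothH hp (1, 0) (0, 1)
  rw [pd_congr hS hp M.pdx_snd, pd_congr hS hp M.pdt_snd, pd_mul hV' hd', pd_mul hF' hc',
    pd_eq_mul_sd hV0, pd_eq_mul_sd hV0, (sd_frame hS M.smoothc M.smoothd M.unit hp).1] at e2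
  have e3 := pd_congr (w := (1, 0)) hS hp M.unit
  rw [pd_const, pd_add (hc'.fun_mul hc') (hd'.fun_mul hd'), pd_mul hc' hc', pd_mul hd' hd'] at e3
  have hVt : pd (1, 0) V p = -(frameCurv V c d p * F p * V p) := by
    linear_combination c p * e1 + d p * e2 - V p / 2 * e3
      + (-pd (1, 0) V p - frameCurv V c d p * F p * V p) * hcd
  refine ⟨hVt, ?_, ?_⟩
  · apply mul_left_cancel₀ hV0
    linear_combination e1 - c p * hVt
  · apply mul_left_cancel₀ hV0
    linear_combination e2 - d p * hVt

lemma evolution_sd (M : NormalMotion S G H V c d F) (hf : ContDiffOn ℝ ∞ f S) (hp : p ∈ S) :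
    pd (1, 0) (sd V f) p = frameCurv V c d p * F p * sd V f p + sd V (pd (1, 0) f) p := by
  have hS := M.isOpen
  have hV' := M.smoothV.differentiableAt_of_isOpen hS hp
  have hs' := (contDiffOn_sd hS M.smoothV M.pos hf).differentiableAt_of_isOpen hS hp
  have hV0 := (M.pos p hp).ne'
  have e := pd_comm hS hf hp (1, 0) (0, 1)
  rw [pd_congr (f := pd (0, 1) f) hS hp (fun q hq => pd_eq_mul_sd (M.pos q hq).ne'),
    pd_mul hV' hs', pd_eq_mul_sd hV0, (M.evolution_frame hp).1] at e
  apply mul_left_cancel₀ hV0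
  linear_combination e

lemma evolution_frameCurv (M : NormalMotion S G H V c d F) (hp : p ∈ S) :
    pd (1, 0) (frameCurv V c d) p
      = sd V (sd V F) p + frameCurv V c d p * frameCurv V c d p * F p := by
  have hS := M.isOpen
  have hc' := M.smoothc.differentiableAt_of_isOpen hS hp
  have hd' := M.smoothd.differentiableAt_of_isOpen hS hp
  have hF1' := (contDiffOn_sd hS M.smoothV M.pos M.smoothF).differentiableAt_of_isOpen hS hp
  have hsc' := (contDiffOn_sd hS M.smoothV M.pos M.smoothc).differentiableAt_of_isOpen hS hp
  have hsd' := (contDiffOn_sd hS M.smoothV M.pos M.smoothd).differentiableAt_of_isOpen hS hp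
  have hV0 := (M.pos p hp).ne'
  obtain ⟨f1, f2⟩ := sd_frame (V := V) hS M.smoothc M.smoothd M.unit hp
  have g1 : sd V (pd (1, 0) c) p = -(sd V (sd V F) p * d p + sd V F p * sd V d p) := by
    have := pd_congr (w := (0, 1)) hS hp (fun q hq => (M.evolution_frame hq).2.1)
    rw [pd_neg, pd_mul hF1' hd'] at this
    simp only [sd] at this ⊢
    linear_combination (V p)⁻¹ * this
  have g2 : sd V (pd (1, 0) d) p = sd V (sd V F) p * c p + sd V F p * sd V c p := by
    have := pd_congr (w := (0, 1)) hS hp (fun q hq => (M.evolution_frame hq).2.2)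
    rw [pd_mul hF1' hc'] at this
    simp only [sd] at this ⊢
    linear_combination (V p)⁻¹ * this
  have e : pd (1, 0) (frameCurv V c d) p = _ := pd_sub (hc'.fun_mul hsd') (hd'.fun_mul hsc')
  rw [pd_mul hc' hsd', pd_mul hd' hsc', M.evolution_sd M.smoothd hp, M.evolution_sd M.smoothc hp,
    g1, g2, (M.evolution_frame hp).2.1, (M.evolution_frame hp).2.2, f1, f2] at e
  linear_combination e + (sd V (sd V F) p
    + frameCurv V c d p * frameCurv V c d p * F p) * M.unit p hp

lemma evolution_sd_frameCurv (M : NormalMotion S G H V c d F) (hp : p ∈ S) :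
    pd (1, 0) (sd V (frameCurv V c d)) p
      = frameCurv V c d p * F p * sd V (frameCurv V c d) p
        + sd V (fun q => sd V (sd V F) q + frameCurv V c d q * frameCurv V c d q * F q) p := by
  rw [M.evolution_sd (contDiffOn_frameCurv M.isOpen M.smoothV M.pos M.smoothc M.smoothd) hp]
  congr 1
  simp only [sd]
  congr 1
  exact pd_congr M.isOpen hp fun q hq => M.evolution_frameCurv hq

lemma evolution_sd_sd_frameCurv (M : NormalMotion S G H V c d F) (hp : p ∈ S) :
    pd (1, 0) (sd V (sd V (frameCurv V c d))) p
      = frameCurv V c d p * F p * sd V (sd V (frameCurv V c d)) p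
        + sd V (fun r => frameCurv V c d r * F r * sd V (frameCurv V c d) r
          + sd V (fun q => sd V (sd V F) q + frameCurv V c d q * frameCurv V c d q * F q) r) p := by
  rw [M.evolution_sd (contDiffOn_sd M.isOpen M.smoothV M.pos
    (contDiffOn_frameCurv M.isOpen M.smoothV M.pos M.smoothc M.smoothd)) hp]
  congr 1
  simp only [sd]
  congr 1
  exact pd_congr M.isOpen hp fun q hq => M.evolution_sd_frameCurv hq

end NormalMotion

end MovingFrame

section CurveFamily

open scoped ContDiff

variable {γ : ℝ → ℝ → E2} {t x : ℝ}

/-- The `i`-th coordinate of a family of plane curves. -/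
def coordFun (γ : ℝ → ℝ → E2) (i : Fin 2) (p : ℝ × ℝ) : ℝ := γ p.1 p.2 i

/-- The speed `|∂ₓγ|` of a family of plane curves. -/
def speedFun (γ : ℝ → ℝ → E2) (p : ℝ × ℝ) : ℝ :=
  √(pd (0, 1) (coordFun γ 0) p ^ 2 + pd (0, 1) (coordFun γ 1) p ^ 2)

/-- The `i`-th coordinate of the unit tangent of a family of plane curves. -/
def tangentFun (γ : ℝ → ℝ → E2) (i : Fin 2) : ℝ × ℝ → ℝ := sd (speedFun γ) (coordFun γ i)

/-- The arc length derivatives of the curvature of a family of plane curves. -/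
def curvFun (γ : ℝ → ℝ → E2) (j : ℕ) : ℝ × ℝ → ℝ :=
  sdIter (speedFun γ) j (frameCurv (speedFun γ) (tangentFun γ 0) (tangentFun γ 1))

/-- The set of points at which a family of plane curves is regular. -/
def regularSet (γ : ℝ → ℝ → E2) : Set (ℝ × ℝ) := {p | 0 < speedFun γ p}

lemma contDiff_coordFun (hγ : ContDiff ℝ ∞ (Function.uncurry γ)) (i : Fin 2) :
    ContDiff ℝ ∞ (coordFun γ i) :=
  contDiff_euclidean.1 hγ i

lemma contDiff_pd_coordFun (hγ : ContDiff ℝ ∞ (Function.uncurry γ)) (i : Fin 2) (w : ℝ × ℝ) :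
    ContDiff ℝ ∞ (pd w (coordFun γ i)) :=
  contDiffOn_univ.1 (contDiffOn_pd isOpen_univ (contDiff_coordFun hγ i).contDiffOn w)

lemma isOpen_regularSet (hγ : ContDiff ℝ ∞ (Function.uncurry γ)) : IsOpen (regularSet γ) := by
  refine isOpen_lt continuous_const (Continuous.sqrt ?_)
  exact ((contDiff_pd_coordFun hγ 0 _).continuous.pow 2).add
    ((contDiff_pd_coordFun hγ 1 _).continuous.pow 2)

lemma contDiffOn_speedFun (hγ : ContDiff ℝ ∞ (Function.uncurry γ)) :
    ContDiffOn ℝ ∞ (speedFun γ) (regularSet γ) := by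
  refine ContDiffOn.sqrt ?_ fun p hp => (Real.sqrt_pos.1 hp).ne'
  exact (((contDiff_pd_coordFun hγ 0 _).pow 2).add
    ((contDiff_pd_coordFun hγ 1 _).pow 2)).contDiffOn

lemma contDiffOn_tangentFun (hγ : ContDiff ℝ ∞ (Function.uncurry γ)) (i : Fin 2) :
    ContDiffOn ℝ ∞ (tangentFun γ i) (regularSet γ) :=
  contDiffOn_sd (isOpen_regularSet hγ) (contDiffOn_speedFun hγ) (fun _ h => h)
    (contDiff_coordFun hγ i).contDiffOn

lemma contDiffOn_curvFun (hγ : ContDiff ℝ ∞ (Function.uncurry γ)) (j : ℕ) :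
    ContDiffOn ℝ ∞ (curvFun γ j) (regularSet γ) :=
  contDiffOn_sdIter (isOpen_regularSet hγ) (contDiffOn_speedFun hγ) (fun _ h => h)
    (contDiffOn_frameCurv (isOpen_regularSet hγ) (contDiffOn_speedFun hγ) (fun _ h => h)
      (contDiffOn_tangentFun hγ 0) (contDiffOn_tangentFun hγ 1)) j

lemma tangentFun_unit {p : ℝ × ℝ} (hp : p ∈ regularSet γ) :
    tangentFun γ 0 p * tangentFun γ 0 p + tangentFun γ 1 p * tangentFun γ 1 p = 1 := by
  have hp' : 0 < speedFun γ p := hp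
  have h : speedFun γ p ^ 2 = _ := Real.sq_sqrt (by positivity)
  simp only [tangentFun, sd]
  field_simp
  exact h.symm

lemma hasDerivWithinAt_E2 {f : ℝ → E2} {f' : E2} {s : Set ℝ} :
    HasDerivWithinAt f f' s x ↔ ∀ i, HasDerivWithinAt (fun y => f y i) (f' i) s x := by
  rw [hasDerivWithinAt_iff_hasFDerivWithinAt, hasFDerivWithinAt_euclidean]
  refine forall_congr' fun i => ?_
  rw [hasDerivWithinAt_iff_hasFDerivWithinAt]
  have h : PiLp.proj (𝕜 := ℝ) 2 (fun _ : Fin 2 => ℝ) i ∘L ContinuousLinearMap.toSpanSingleton ℝ f'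
      = ContinuousLinearMap.toSpanSingleton ℝ (f' i) := by
    ext
    simp
  exact iff_of_eq (congrArg (fun g => HasFDerivWithinAt (fun y => f y i) g s x) h)

lemma hasDerivAt_E2 {f : ℝ → E2} {f' : E2} :
    HasDerivAt f f' x ↔ ∀ i, HasDerivAt (fun y => f y i) (f' i) x := by
  simpa using hasDerivWithinAt_E2 (f := f) (f' := f') (s := univ)

lemma deriv_apply (hγ : ContDiff ℝ ∞ (Function.uncurry γ)) (t x : ℝ) (i : Fin 2) :
    deriv (γ t) x i = pd (0, 1) (coordFun γ i) (t, x) := by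
  have h : HasDerivAt (γ t) (deriv (γ t) x) x := by
    refine DifferentiableAt.hasDerivAt ?_
    exact ((hγ.comp (contDiff_prodMk_right t)).differentiable (by simp)) x
  exact (hasDerivAt_E2.1 h i).unique
    (hasDerivAt_slice_snd ((contDiff_coordFun hγ i).differentiable (by simp) (t, x)))

lemma norm_deriv_eq (hγ : ContDiff ℝ ∞ (Function.uncurry γ)) (t x : ℝ) :
    ‖deriv (γ t) x‖ = speedFun γ (t, x) := by
  simp [EuclideanSpace.norm_eq, Fin.sum_univ_two, speedFun, deriv_apply hγ]

lemma mem_regularSet (hγ : ContDiff ℝ ∞ (Function.uncurry γ)) (h : deriv (γ t) x ≠ 0) :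
    (t, x) ∈ regularSet γ := by
  change 0 < speedFun γ (t, x)
  rw [← norm_deriv_eq hγ]
  exact norm_pos_iff.2 h

lemma utangent_apply (hγ : ContDiff ℝ ∞ (Function.uncurry γ)) (t x : ℝ) (i : Fin 2) :
    utangent (γ t) x i = tangentFun γ i (t, x) := by
  simp [utangent, aderivVec, tangentFun, sd, norm_deriv_eq hγ, deriv_apply hγ]

lemma rot_zero (v : E2) : rot v 0 = -v 1 := rfl

lemma rot_one (v : E2) : rot v 1 = v 0 := rfl

lemma curv_eq (hγ : ContDiff ℝ ∞ (Function.uncurry γ)) (hp : (t, x) ∈ regularSet γ) :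
    curv (γ t) x = curvFun γ 0 (t, x) := by
  have h : HasDerivAt (utangent (γ t))
      (WithLp.toLp 2 fun i => pd (0, 1) (tangentFun γ i) (t, x)) x := by
    refine hasDerivAt_E2.2 fun i => ?_
    simp only [utangent_apply hγ]
    exact hasDerivAt_slice_snd
      ((contDiffOn_tangentFun hγ i).differentiableAt_of_isOpen (isOpen_regularSet hγ) hp)
  simp only [curv, aderivVec, h.deriv, norm_deriv_eq hγ, unormal, PiLp.inner_apply,
    Fin.sum_univ_two, rot_zero, rot_one, utangent_apply hγ, PiLp.smul_apply, curvFun, sdIter,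
    frameCurv, sd, RCLike.inner_apply, conj_trivial, smul_eq_mul]
  ring

lemma eventually_slice_mem_regularSet (hγ : ContDiff ℝ ∞ (Function.uncurry γ))
    (hp : (t, x) ∈ regularSet γ) : ∀ᶠ y in nhds x, (t, y) ∈ regularSet γ :=
  (Continuous.prodMk_right t).continuousAt.preimage_mem_nhds
    ((isOpen_regularSet hγ).mem_nhds hp)

lemma hasDerivAt_curvFun (hγ : ContDiff ℝ ∞ (Function.uncurry γ)) (hp : (t, x) ∈ regularSet γ)
    (j : ℕ) :
    HasDerivAt (fun y => curvFun γ j (t, y)) (speedFun γ (t, x) * curvFun γ (j + 1) (t, x)) x := by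
  have h := hasDerivAt_slice_snd
    ((contDiffOn_curvFun hγ j).differentiableAt_of_isOpen (isOpen_regularSet hγ) hp)
  rwa [pd_eq_mul_sd (V := speedFun γ) (ne_of_gt hp)] at h

lemma kds_eq (hγ : ContDiff ℝ ∞ (Function.uncurry γ)) (j : ℕ) (hp : (t, x) ∈ regularSet γ) :
    kds (γ t) j x = curvFun γ j (t, x) := by
  induction j generalizing x with
  | zero => exact curv_eq hγ hp
  | succ j ih =>
    have h : kds (γ t) j =ᶠ[nhds x] fun y => curvFun γ j (t, y) :=
      (eventually_slice_mem_regularSet hγ hp).mono fun y hy => ih hy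
    change (‖deriv (γ t) x‖)⁻¹ * deriv (kds (γ t) j) x = _
    have hV0 : speedFun γ (t, x) ≠ 0 := ne_of_gt hp
    rw [h.deriv_eq, (hasDerivAt_curvFun hγ hp j).deriv, norm_deriv_eq hγ, inv_mul_cancel_left₀ hV0]

/-- The normal speed `k_{s⁴} + k² k_{ss} - (1/2) k k_s²`. -/
def flowSpeed (γ : ℝ → ℝ → E2) (p : ℝ × ℝ) : ℝ :=
  curvFun γ 4 p + curvFun γ 0 p ^ 2 * curvFun γ 2 p - 1 / 2 * curvFun γ 0 p * curvFun γ 1 p ^ 2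

lemma contDiffOn_flowSpeed (hγ : ContDiff ℝ ∞ (Function.uncurry γ)) :
    ContDiffOn ℝ ∞ (flowSpeed γ) (regularSet γ) :=
  ((contDiffOn_curvFun hγ 4).add (((contDiffOn_curvFun hγ 0).pow 2).mul
    (contDiffOn_curvFun hγ 2))).sub
      ((contDiffOn_const.mul (contDiffOn_curvFun hγ 0)).mul ((contDiffOn_curvFun hγ 1).pow 2))

lemma speedF_eq (hγ : ContDiff ℝ ∞ (Function.uncurry γ)) (hp : (t, x) ∈ regularSet γ) :
    speedF (γ t) x = flowSpeed γ (t, x) := by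
  simp [speedF, flowSpeed, kds_eq hγ _ hp, curv_eq hγ hp]

end CurveFamily

section ParametricIntegral

open scoped ContDiff

variable {U : Set (ℝ × ℝ)} {A : ℝ × ℝ → ℝ} {t : ℝ}

lemma eventually_forall_mem (hU : IsOpen U) (ht : ∀ x ∈ Icc (-1:ℝ) 1, (t, x) ∈ U) :
    ∀ᶠ u in nhds t, ∀ x ∈ Icc (-1:ℝ) 1, (u, x) ∈ U :=
  isCompact_Icc.eventually_forall_of_forall_eventually fun x hx => hU.mem_nhds (ht x hx)

lemma hasDerivAt_integral_slice (hU : IsOpen U) (hA : ContDiffOn ℝ ∞ A U)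
    (ht : ∀ x ∈ Icc (-1:ℝ) 1, (t, x) ∈ U) :
    HasDerivAt (fun u => ∫ x in (-1:ℝ)..1, A (u, x)) (∫ x in (-1:ℝ)..1, pd (1, 0) A (t, x)) t := by
  obtain ⟨ε, hε, hball⟩ := Metric.eventually_nhds_iff_ball.1 (eventually_forall_mem hU ht)
  have hI : uIoc (-1:ℝ) 1 ⊆ Icc (-1) 1 := by
    rw [uIoc_of_le (by norm_num)]
    exact Ioc_subset_Icc_self
  have hKU : Metric.closedBall t (ε / 2) ×ˢ Icc (-1:ℝ) 1 ⊆ U := fun q hq =>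
    hball q.1 (Metric.closedBall_subset_ball (by linarith) hq.1) q.2 hq.2
  have hpd := (contDiffOn_pd hU hA (1, 0)).continuousOn
  obtain ⟨C, hC⟩ := ((isCompact_closedBall t (ε / 2)).prod
    (isCompact_Icc (a := (-1:ℝ)) (b := 1))).exists_bound_of_continuousOn (hpd.mono hKU)
  have hslice : ∀ {B : ℝ × ℝ → ℝ}, ContinuousOn B U → ∀ u ∈ Metric.ball t ε,
      IntervalIntegrable (fun x => B (u, x)) volume (-1) 1 := fun hB u hu =>
    intervalIntegrable_of_continuousOn_Icc (hB.comp (by fun_prop) fun x hx => hball u hu x hx)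
  have hmeas : ∀ {B : ℝ × ℝ → ℝ}, ContinuousOn B U → ∀ u ∈ Metric.ball t ε,
      AEStronglyMeasurable (fun x => B (u, x)) (volume.restrict (uIoc (-1:ℝ) 1)) := fun hB u hu =>
    (intervalIntegrable_iff.1 (hslice hB u hu)).aestronglyMeasurable
  have ht0 := Metric.mem_ball_self (x := t) hε
  refine (hasDerivAt_integral_of_dominated_loc_of_deriv_le (bound := fun _ => C)
    (F := fun u x => A (u, x)) (F' := fun u x => pd (1, 0) A (u, x))
    (Metric.closedBall_mem_nhds t (half_pos hε)) ?_ (hslice hA.continuousOn t ht0)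
    (hmeas hpd t ht0) ?_ intervalIntegrable_const ?_).2
  · filter_upwards [Metric.ball_mem_nhds t hε] with u hu using hmeas hA.continuousOn u hu
  · exact Filter.Eventually.of_forall fun x hx u hu => hC (u, x) ⟨hu, hI hx⟩
  · exact Filter.Eventually.of_forall fun x hx u hu => hasDerivAt_slice_fst
      (hA.differentiableAt_of_isOpen hU (hKU (show (u, x) ∈ _ from ⟨hu, hI hx⟩)))

end ParametricIntegral

section TimeDomain

variable {T : ℝ≥0∞} {f g : ℝ × ℝ → ℝ} {t x : ℝ}

/-- The interior of the space-time domain. -/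
def flowDomain (T : ℝ≥0∞) : Set (ℝ × ℝ) := ({t | ENNReal.ofReal t < T} ∩ Ioi 0) ×ˢ Ioo (-1) 1

/-- The space-time domain `[0, T) × [-1, 1]`. -/
def flowSlab (T : ℝ≥0∞) : Set (ℝ × ℝ) := {p | inTime T p.1 ∧ p.2 ∈ Icc (-1:ℝ) 1}

lemma isOpen_ofReal_lt (T : ℝ≥0∞) : IsOpen {t : ℝ | ENNReal.ofReal t < T} :=
  isOpen_lt ENNReal.continuous_ofReal continuous_const

lemma isOpen_flowDomain (T : ℝ≥0∞) : IsOpen (flowDomain T) :=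
  ((isOpen_ofReal_lt T).inter isOpen_Ioi).prod isOpen_Ioo

lemma flowDomain_subset_flowSlab : flowDomain T ⊆ flowSlab T := fun _ hp =>
  ⟨⟨le_of_lt hp.1.2, hp.1.1⟩, Ioo_subset_Icc_self hp.2⟩

lemma flowSlab_subset_closure : flowSlab T ⊆ closure (flowDomain T) := by
  intro p hp
  rw [flowDomain, closure_prod_eq, closure_Ioo (by norm_num)]
  refine ⟨(isOpen_ofReal_lt T).inter_closure ⟨hp.1.2, ?_⟩, hp.2⟩
  rw [closure_Ioi]
  exact hp.1.1

/-- A function of `(t, x)` that vanishes at `x` for all times has vanishing time derivative. -/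
lemma pd_eq_zero_of_forall (hf : DifferentiableAt ℝ f (t, x)) (ht : inTime T t)
    (h : ∀ u, inTime T u → f (u, x) = 0) : pd (1, 0) f (t, x) = 0 := by
  have h1 := (hasDerivAt_slice_fst hf).hasDerivWithinAt (s := Ici t)
  have h2 : HasDerivWithinAt (fun u => f (u, x)) 0 (Ici t) t := by
    refine (hasDerivWithinAt_const t (Ici t) (0:ℝ)).congr_of_eventuallyEq ?_ (h t ht)
    filter_upwards [self_mem_nhdsWithin,
      mem_nhdsWithin_of_mem_nhds ((isOpen_ofReal_lt T).mem_nhds ht.2)] with u hu hu'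
    exact h u ⟨ht.1.trans hu, hu'⟩
  exact (uniqueDiffWithinAt_Ici t).eq_deriv _ h1 h2

end TimeDomain

namespace SixthFlow

open scoped ContDiff

variable {T : ℝ≥0∞} (Φ : SixthFlow T) {f g : ℝ × ℝ → ℝ} {p : ℝ × ℝ} {t x : ℝ}

lemma mem_regularSet_of_inTime (ht : inTime T t) (hx : x ∈ Icc (-1:ℝ) 1) :
    (t, x) ∈ regularSet Φ.γ :=
  mem_regularSet Φ.smooth (Φ.regular ht hx)

lemma flowSlab_subset : flowSlab T ⊆ regularSet Φ.γ := fun _ hp =>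
  Φ.mem_regularSet_of_inTime hp.1 hp.2

lemma flowDomain_subset : flowDomain T ⊆ regularSet Φ.γ :=
  flowDomain_subset_flowSlab.trans Φ.flowSlab_subset

lemma pdt_coordFun (hp : p ∈ flowDomain T) (i : Fin 2) :
    pd (1, 0) (coordFun Φ.γ i) p
      = flowSpeed Φ.γ p * unormal (Φ.γ p.1) p.2 i := by
  have hs := flowDomain_subset_flowSlab hp
  have h := (Φ.flow hs.1 hs.2).hasDerivAt (Ici_mem_nhds hp.1.2)
  have h' := hasDerivAt_E2.1 h i
  rw [speedF_eq Φ.smooth (Φ.flowSlab_subset hs)] at h'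
  exact (hasDerivAt_slice_fst (t := p.1) (x := p.2)
    ((contDiff_coordFun Φ.smooth i).differentiable (by simp) p)).unique h'

lemma normalMotion : NormalMotion (flowDomain T) (coordFun Φ.γ 0) (coordFun Φ.γ 1)
    (speedFun Φ.γ) (tangentFun Φ.γ 0) (tangentFun Φ.γ 1) (flowSpeed Φ.γ) where
  isOpen := isOpen_flowDomain T
  smoothG := (contDiff_coordFun Φ.smooth 0).contDiffOn
  smoothH := (contDiff_coordFun Φ.smooth 1).contDiffOn
  smoothV := (contDiffOn_speedFun Φ.smooth).mono Φ.flowDomain_subset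
  smoothc := (contDiffOn_tangentFun Φ.smooth 0).mono Φ.flowDomain_subset
  smoothd := (contDiffOn_tangentFun Φ.smooth 1).mono Φ.flowDomain_subset
  smoothF := (contDiffOn_flowSpeed Φ.smooth).mono Φ.flowDomain_subset
  pos := Φ.flowDomain_subset
  unit := fun _ hq => tangentFun_unit (Φ.flowDomain_subset hq)
  pdx_fst := fun _ hq => pd_eq_mul_sd (ne_of_gt (Φ.flowDomain_subset hq))
  pdx_snd := fun _ hq => pd_eq_mul_sd (ne_of_gt (Φ.flowDomain_subset hq))
  pdt_fst := fun q hq => by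
    rw [Φ.pdt_coordFun hq, unormal, rot_zero, utangent_apply Φ.smooth]
    ring
  pdt_snd := fun q hq => by
    rw [Φ.pdt_coordFun hq, unormal, rot_one, utangent_apply Φ.smooth]

lemma eqOn_flowSlab (hf : ContinuousOn f (regularSet Φ.γ)) (hg : ContinuousOn g (regularSet Φ.γ))
    (h : ∀ q ∈ flowDomain T, f q = g q) : ∀ q ∈ flowSlab T, f q = g q :=
  Set.EqOn.of_subset_closure h (hf.mono Φ.flowSlab_subset) (hg.mono Φ.flowSlab_subset)
    flowDomain_subset_flowSlab flowSlab_subset_closure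

/-- The time derivative of the curvature, `F_{ss} + k² F`. -/
def curvRate (p : ℝ × ℝ) : ℝ :=
  sd (speedFun Φ.γ) (sd (speedFun Φ.γ) (flowSpeed Φ.γ)) p
    + curvFun Φ.γ 0 p * curvFun Φ.γ 0 p * flowSpeed Φ.γ p

/-- The time derivative of the first arc length derivative of the curvature. -/
def curvDerivRate (p : ℝ × ℝ) : ℝ :=
  curvFun Φ.γ 0 p * flowSpeed Φ.γ p * curvFun Φ.γ 1 p + sd (speedFun Φ.γ) Φ.curvRate p

lemma contDiffOn_sd_speedFun (hf : ContDiffOn ℝ ∞ f (regularSet Φ.γ)) :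
    ContDiffOn ℝ ∞ (sd (speedFun Φ.γ) f) (regularSet Φ.γ) :=
  contDiffOn_sd (isOpen_regularSet Φ.smooth) (contDiffOn_speedFun Φ.smooth) (fun _ h => h) hf

lemma contDiffOn_curvRate : ContDiffOn ℝ ∞ Φ.curvRate (regularSet Φ.γ) :=
  (Φ.contDiffOn_sd_speedFun (Φ.contDiffOn_sd_speedFun (contDiffOn_flowSpeed Φ.smooth))).add
    (((contDiffOn_curvFun Φ.smooth 0).mul (contDiffOn_curvFun Φ.smooth 0)).mul
      (contDiffOn_flowSpeed Φ.smooth))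

lemma contDiffOn_curvDerivRate : ContDiffOn ℝ ∞ Φ.curvDerivRate (regularSet Φ.γ) :=
  (((contDiffOn_curvFun Φ.smooth 0).mul (contDiffOn_flowSpeed Φ.smooth)).mul
    (contDiffOn_curvFun Φ.smooth 1)).add (Φ.contDiffOn_sd_speedFun Φ.contDiffOn_curvRate)

lemma continuousOn_pd (hf : ContDiffOn ℝ ∞ f (regularSet Φ.γ)) (w : ℝ × ℝ) :
    ContinuousOn (pd w f) (regularSet Φ.γ) :=
  (contDiffOn_pd (isOpen_regularSet Φ.smooth) hf w).continuousOn

lemma pdt_speedFun (hp : p ∈ flowSlab T) :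
    pd (1, 0) (speedFun Φ.γ) p = -(curvFun Φ.γ 0 p * flowSpeed Φ.γ p * speedFun Φ.γ p) := by
  have hV := contDiffOn_speedFun Φ.smooth
  refine Φ.eqOn_flowSlab (Φ.continuousOn_pd hV _) ?_
    (fun q hq => (Φ.normalMotion.evolution_frame hq).1) p hp
  exact (((contDiffOn_curvFun Φ.smooth 0).mul (contDiffOn_flowSpeed Φ.smooth)).mul
    hV).neg.continuousOn

lemma pdt_tangentFun_one (hp : p ∈ flowSlab T) :
    pd (1, 0) (tangentFun Φ.γ 1) p
      = sd (speedFun Φ.γ) (flowSpeed Φ.γ) p * tangentFun Φ.γ 0 p := by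
  refine Φ.eqOn_flowSlab (Φ.continuousOn_pd (contDiffOn_tangentFun Φ.smooth 1) _) ?_
    (fun q hq => (Φ.normalMotion.evolution_frame hq).2.2) p hp
  exact ((Φ.contDiffOn_sd_speedFun (contDiffOn_flowSpeed Φ.smooth)).mul
    (contDiffOn_tangentFun Φ.smooth 0)).continuousOn

lemma pdt_curvFun_one (hp : p ∈ flowSlab T) :
    pd (1, 0) (curvFun Φ.γ 1) p = Φ.curvDerivRate p :=
  Φ.eqOn_flowSlab (Φ.continuousOn_pd (contDiffOn_curvFun Φ.smooth 1) _)
    Φ.contDiffOn_curvDerivRate.continuousOn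
    (fun _ hq => Φ.normalMotion.evolution_sd_frameCurv hq) p hp

lemma pdt_curvFun_two (hp : p ∈ flowSlab T) :
    pd (1, 0) (curvFun Φ.γ 2) p
      = curvFun Φ.γ 0 p * flowSpeed Φ.γ p * curvFun Φ.γ 2 p
        + sd (speedFun Φ.γ) Φ.curvDerivRate p := by
  refine Φ.eqOn_flowSlab (Φ.continuousOn_pd (contDiffOn_curvFun Φ.smooth 2) _) ?_
    (fun q hq => Φ.normalMotion.evolution_sd_sd_frameCurv hq) p hp
  exact ((((contDiffOn_curvFun Φ.smooth 0).mul (contDiffOn_flowSpeed Φ.smooth)).mul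
    (contDiffOn_curvFun Φ.smooth 2)).add
      (Φ.contDiffOn_sd_speedFun Φ.contDiffOn_curvDerivRate)).continuousOn

/-- The arc length derivative along a time slice. -/
lemma hasDerivAt_slice (hf : ContDiffOn ℝ ∞ f (regularSet Φ.γ)) (hp : (t, x) ∈ regularSet Φ.γ) :
    HasDerivAt (fun y => f (t, y)) (speedFun Φ.γ (t, x) * sd (speedFun Φ.γ) f (t, x)) x := by
  rw [← pd_eq_mul_sd (ne_of_gt hp)]
  exact hasDerivAt_slice_snd (hf.differentiableAt_of_isOpen (isOpen_regularSet Φ.smooth) hp)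

lemma sd_flowSpeed (hp : (t, x) ∈ regularSet Φ.γ) :
    sd (speedFun Φ.γ) (flowSpeed Φ.γ) (t, x)
      = curvFun Φ.γ 5 (t, x) + curvFun Φ.γ 0 (t, x) * curvFun Φ.γ 1 (t, x) * curvFun Φ.γ 2 (t, x)
        + curvFun Φ.γ 0 (t, x) ^ 2 * curvFun Φ.γ 3 (t, x) - 1 / 2 * curvFun Φ.γ 1 (t, x) ^ 3 := by
  have hk := hasDerivAt_curvFun Φ.smooth hp
  have h := ((hk 4).add (((hk 0).pow 2).mul (hk 2))).sub
    (((hk 0).const_mul (1 / 2)).mul ((hk 1).pow 2))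
  have e := (Φ.hasDerivAt_slice (contDiffOn_flowSpeed Φ.smooth) hp).unique h
  have hV : speedFun Φ.γ (t, x) ≠ 0 := ne_of_gt hp
  apply mul_left_cancel₀ hV
  rw [e]
  simp
  ring

section Boundary

variable {e : ℝ}

lemma sd_flowSpeed_boundary (B : BC Φ e) (ht : inTime T t) (hx : x = -1 ∨ x = 1) :
    sd (speedFun Φ.γ) (flowSpeed Φ.γ) (t, x) = 0 := by
  have hxI : x ∈ Icc (-1:ℝ) 1 := by rcases hx with rfl | rfl <;> norm_num
  have hp : (t, x) ∈ flowSlab T := ⟨ht, hxI⟩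
  have hd : ∀ u, inTime T u → tangentFun Φ.γ 1 (u, x) = 0 := by
    intro u hu
    have h : unormal (Φ.γ u) x 0 = 0 := by
      rcases hx with rfl | rfl
      exacts [(B.neumann hu).1, (B.neumann hu).2]
    rwa [unormal, rot_zero, utangent_apply Φ.smooth, neg_eq_zero] at h
  have h0 := pd_eq_zero_of_forall ((contDiffOn_tangentFun Φ.smooth 1).differentiableAt_of_isOpen
    (isOpen_regularSet Φ.smooth) (Φ.flowSlab_subset hp)) ht hd
  rw [Φ.pdt_tangentFun_one hp] at h0
  have h1 := tangentFun_unit (Φ.flowSlab_subset hp)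
  rw [hd t ht] at h1
  rcases mul_eq_zero.1 h0 with h | h
  · exact h
  · simp [h] at h1

lemma curvFun_boundary (B : BC Φ e) (ht : inTime T t) (hx : x = -1 ∨ x = 1) :
    curvFun Φ.γ 1 (t, x) = 0 ∧ curvFun Φ.γ 3 (t, x) = 0 := by
  have hxI : x ∈ Icc (-1:ℝ) 1 := by rcases hx with rfl | rfl <;> norm_num
  have hp := Φ.mem_regularSet_of_inTime ht hxI
  rw [← kds_eq Φ.smooth 1 hp, ← kds_eq Φ.smooth 3 hp]
  rcases hx with rfl | rfl
  exacts [⟨(B.noflux ht).1, (B.noflux3 ht).1⟩, ⟨(B.noflux ht).2, (B.noflux3 ht).2⟩]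

lemma curvDerivRate_boundary (B : BC Φ e) (ht : inTime T t) (hx : x = -1 ∨ x = 1) :
    Φ.curvDerivRate (t, x) = 0 := by
  have hxI : x ∈ Icc (-1:ℝ) 1 := by rcases hx with rfl | rfl <;> norm_num
  have hp : (t, x) ∈ flowSlab T := ⟨ht, hxI⟩
  rw [← Φ.pdt_curvFun_one hp]
  exact pd_eq_zero_of_forall ((contDiffOn_curvFun Φ.smooth 1).differentiableAt_of_isOpen
    (isOpen_regularSet Φ.smooth) (Φ.flowSlab_subset hp)) ht
      fun u hu => (Φ.curvFun_boundary B hu hx).1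

end Boundary

lemma continuousOn_slice (hf : ContDiffOn ℝ ∞ f (regularSet Φ.γ)) (ht : inTime T t) :
    ContinuousOn (fun x => f (t, x)) (Icc (-1) 1) :=
  hf.continuousOn.comp (by fun_prop) fun _ hx => Φ.mem_regularSet_of_inTime ht hx

/-- The boundary term in the evolution of `‖k_{ss}‖₂²`. -/
def boundaryTerm (p : ℝ × ℝ) : ℝ :=
  2 * (curvFun Φ.γ 2 p * Φ.curvDerivRate p - curvFun Φ.γ 3 p * Φ.curvRate p
    + curvFun Φ.γ 4 p * sd (speedFun Φ.γ) (flowSpeed Φ.γ) p)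

/-- The time derivative of `k_{ss}² ds`, up to an exact derivative. -/
lemma pdt_sq_curvFun_mul_speedFun (hp : p ∈ flowSlab T) :
    pd (1, 0) (fun q => curvFun Φ.γ 2 q * curvFun Φ.γ 2 q * speedFun Φ.γ q) p
      = (2 * curvFun Φ.γ 2 p * (curvFun Φ.γ 0 p * flowSpeed Φ.γ p * curvFun Φ.γ 2 p
          + sd (speedFun Φ.γ) Φ.curvDerivRate p)
        - curvFun Φ.γ 2 p ^ 2 * (curvFun Φ.γ 0 p * flowSpeed Φ.γ p)) * speedFun Φ.γ p := by
  have hU := isOpen_regularSet Φ.smooth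
  have hp' := Φ.flowSlab_subset hp
  have hk := (contDiffOn_curvFun Φ.smooth 2).differentiableAt_of_isOpen hU hp'
  have hV := (contDiffOn_speedFun Φ.smooth).differentiableAt_of_isOpen hU hp'
  rw [pd_mul (hk.fun_mul hk) hV, pd_mul hk hk, Φ.pdt_curvFun_two hp, Φ.pdt_speedFun hp]
  ring

lemma hasDerivAt_boundaryTerm (hp : (t, x) ∈ regularSet Φ.γ) :
    HasDerivAt (fun y => Φ.boundaryTerm (t, y)) (speedFun Φ.γ (t, x) *
      (2 * curvFun Φ.γ 2 (t, x) * (curvFun Φ.γ 0 (t, x) * flowSpeed Φ.γ (t, x)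
          * curvFun Φ.γ 2 (t, x) + sd (speedFun Φ.γ) Φ.curvDerivRate (t, x))
        - curvFun Φ.γ 2 (t, x) ^ 2 * (curvFun Φ.γ 0 (t, x) * flowSpeed Φ.γ (t, x))
        - evolutionIntegrand (fun j y => curvFun Φ.γ j (t, y)) x)) x := by
  have hk := hasDerivAt_curvFun Φ.smooth hp
  have hF := contDiffOn_flowSpeed Φ.smooth
  have h := ((((hk 2).mul (Φ.hasDerivAt_slice Φ.contDiffOn_curvDerivRate hp)).sub
    ((hk 3).mul (Φ.hasDerivAt_slice Φ.contDiffOn_curvRate hp))).add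
      ((hk 4).mul (Φ.hasDerivAt_slice (Φ.contDiffOn_sd_speedFun hF) hp))).const_mul 2
  refine h.congr_deriv ?_
  simp only [evolutionIntegrand, ← Φ.sd_flowSpeed hp]
  simp only [curvDerivRate, curvRate, flowSpeed]
  ring

lemma knorm2_eq (ht : inTime T t) (j : ℕ) :
    knorm2 (Φ.γ t) j = ∫ x in (-1:ℝ)..1, curvFun Φ.γ j (t, x) ^ 2 * speedFun Φ.γ (t, x) := by
  refine integral_congr fun x hx => ?_
  rw [uIcc_of_le (by norm_num)] at hx
  simp only [kds_eq Φ.smooth j (Φ.mem_regularSet_of_inTime ht hx), norm_deriv_eq Φ.smooth]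

lemma clen_eq (t : ℝ) : clen (Φ.γ t) = ∫ x in (-1:ℝ)..1, speedFun Φ.γ (t, x) := by
  simp [clen, cint, norm_deriv_eq Φ.smooth]

lemma totalK_eq (ht : inTime T t) :
    totalK (Φ.γ t) = ∫ x in (-1:ℝ)..1, curvFun Φ.γ 0 (t, x) * speedFun Φ.γ (t, x) := by
  refine integral_congr fun x hx => ?_
  rw [uIcc_of_le (by norm_num)] at hx
  simp only [curv_eq Φ.smooth (Φ.mem_regularSet_of_inTime ht hx), norm_deriv_eq Φ.smooth]

/-- Primitives along a time slice. -/
lemma hasDerivAt_integral_slice_snd (hf : ContDiffOn ℝ ∞ f (regularSet Φ.γ)) (ht : inTime T t)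
    (hx : x ∈ Icc (-1:ℝ) 1) :
    HasDerivAt (fun y => ∫ z in (-1:ℝ)..y, f (t, z)) (f (t, x)) x := by
  have hO : IsOpen {z | (t, z) ∈ regularSet Φ.γ} :=
    (isOpen_regularSet Φ.smooth).preimage (Continuous.prodMk_right t)
  have hc : ContinuousOn (fun z => f (t, z)) {z | (t, z) ∈ regularSet Φ.γ} :=
    hf.continuousOn.comp (by fun_prop) fun _ hz => hz
  have hxO : x ∈ {z | (t, z) ∈ regularSet Φ.γ} := Φ.mem_regularSet_of_inTime ht hx
  refine integral_hasDerivAt_right ?_ (hc.stronglyMeasurableAtFilter hO x hxO)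
    (hc.continuousAt (hO.mem_nhds hxO))
  refine ((Φ.continuousOn_slice hf ht).mono ?_).intervalIntegrable
  rw [uIcc_of_le hx.1]
  exact Icc_subset_Icc_right hx.2

lemma hasDerivWithinAt_knorm2 {e : ℝ} (B : BC Φ e) (ht : inTime T t) :
    HasDerivWithinAt (fun u => knorm2 (Φ.γ u) 2)
      (∫ x in (-1:ℝ)..1, evolutionIntegrand (fun j y => curvFun Φ.γ j (t, y)) x
        * speedFun Φ.γ (t, x)) (Ici 0) t := by
  have hk := contDiffOn_curvFun Φ.smooth
  have hV := contDiffOn_speedFun Φ.smooth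
  have hF := contDiffOn_flowSpeed Φ.smooth
  have h := hasDerivAt_integral_slice (isOpen_regularSet Φ.smooth) (((hk 2).mul (hk 2)).mul hV)
    fun x hx => Φ.mem_regularSet_of_inTime ht hx
  have hev : (fun u => knorm2 (Φ.γ u) 2) =ᶠ[nhdsWithin t (Ici 0)] fun u =>
      ∫ x in (-1:ℝ)..1, curvFun Φ.γ 2 (u, x) * curvFun Φ.γ 2 (u, x) * speedFun Φ.γ (u, x) := by
    filter_upwards [self_mem_nhdsWithin,
      mem_nhdsWithin_of_mem_nhds ((isOpen_ofReal_lt T).mem_nhds ht.2)] with u hu hu'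
    simp only [Φ.knorm2_eq ⟨hu, hu'⟩, sq]
  refine (h.hasDerivWithinAt.congr_of_eventuallyEq hev (by simp only [Φ.knorm2_eq ht, sq])
    ).congr_deriv ?_
  have hcV := Φ.continuousOn_slice hV ht
  have hck := fun j => Φ.continuousOn_slice (hk j) ht
  have hcF := Φ.continuousOn_slice hF ht
  have hcQ := Φ.continuousOn_slice (Φ.contDiffOn_sd_speedFun Φ.contDiffOn_curvDerivRate) ht
  have hcE : ContinuousOn (evolutionIntegrand (fun j y => curvFun Φ.γ j (t, y))) (Icc (-1) 1) := by
    have h0 := hck 0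
    have h1 := hck 1
    have h2 := hck 2
    have h3 := hck 3
    have h4 := hck 4
    have h5 := hck 5
    unfold evolutionIntegrand
    fun_prop
  have hcD : ContinuousOn (fun x => 2 * curvFun Φ.γ 2 (t, x) * (curvFun Φ.γ 0 (t, x)
      * flowSpeed Φ.γ (t, x) * curvFun Φ.γ 2 (t, x) + sd (speedFun Φ.γ) Φ.curvDerivRate (t, x))
        - curvFun Φ.γ 2 (t, x) ^ 2 * (curvFun Φ.γ 0 (t, x) * flowSpeed Φ.γ (t, x)))
      (Icc (-1) 1) := by
    have h0 := hck 0
    have h2 := hck 2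
    fun_prop
  have hW := weighted_integral_deriv hcV (hcD.sub hcE)
    fun x hx => Φ.hasDerivAt_boundaryTerm (Φ.mem_regularSet_of_inTime ht hx)
  have hb : ∀ x : ℝ, x = -1 ∨ x = 1 → Φ.boundaryTerm (t, x) = 0 := fun x hx => by
    simp [boundaryTerm, Φ.sd_flowSpeed_boundary B ht hx, Φ.curvDerivRate_boundary B ht hx,
      (Φ.curvFun_boundary B ht hx).2]
  rw [hb 1 (Or.inr rfl), hb (-1) (Or.inl rfl), sub_zero] at hW
  have hDV := intervalIntegrable_of_continuousOn_Icc (hcD.mul hcV)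
  have hEV := intervalIntegrable_of_continuousOn_Icc (hcE.mul hcV)
  have hsub := integral_sub hDV hEV
  refine Eq.trans ?_ (sub_eq_zero.1 (hsub.symm.trans (Eq.trans ?_ hW)))
  · refine integral_congr fun x hx => ?_
    rw [uIcc_of_le (by norm_num)] at hx
    exact Φ.pdt_sq_curvFun_mul_speedFun ⟨ht, hx⟩
  · exact integral_congr fun x _ => (sub_mul _ _ _).symm

end SixthFlow

/-- **Evolution of `‖k_{ss}‖₂²`.**  If under the flow `ω(t) = 0` for all `t ∈ [0,T)`, then
`(d/dt) ∫_γ k_{ss}² ds ≤ [-2 + (74L³/π³)‖k_s‖₂² + (174L⁶/π⁶)‖k_s‖₂⁴] ‖k_{s⁵}‖₂²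
  - (3/L) ‖k_{ss}‖₂⁴`. -/
theorem evolution_kss_L2 {T : ℝ≥0∞} (Φ : SixthFlow T) (e : ℝ) (B : BC Φ e)
    (hω : ∀ t : ℝ, inTime T t → 1 / (2 * π) * totalK (Φ.γ t) = 0)
    {t : ℝ} (ht : inTime T t) :
    ∃ D : ℝ, HasDerivWithinAt (fun u => knorm2 (Φ.γ u) 2) D (Ici 0) t ∧
      D ≤ (-2 + 74 * (clen (Φ.γ t)) ^ 3 / π ^ 3 * knorm2 (Φ.γ t) 1
            + 174 * (clen (Φ.γ t)) ^ 6 / π ^ 6 * (knorm2 (Φ.γ t) 1) ^ 2)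
            * knorm2 (Φ.γ t) 5
          - 3 / clen (Φ.γ t) * (knorm2 (Φ.γ t) 2) ^ 2 := by
  refine ⟨_, Φ.hasDerivWithinAt_knorm2 B ht, ?_⟩
  have hk := contDiffOn_curvFun Φ.smooth
  have hV := contDiffOn_speedFun Φ.smooth
  have htot : totalK (Φ.γ t) = 0 := by
    simpa [Real.pi_ne_zero] using hω t ht
  rw [Φ.totalK_eq ht] at htot
  rw [Φ.clen_eq, Φ.knorm2_eq ht 1, Φ.knorm2_eq ht 2, Φ.knorm2_eq ht 5]
  refine integral_evolutionIntegrand_le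
    (θ := fun y => ∫ z in (-1:ℝ)..y, curvFun Φ.γ 0 (t, z) * speedFun Φ.γ (t, z))
    (Φ.continuousOn_slice hV ht)
    (fun x hx => Φ.mem_regularSet_of_inTime ht hx)
    (fun x hx => Φ.hasDerivAt_integral_slice_snd hV ht hx)
    (fun x hx => ?_)
    (fun j x hx => hasDerivAt_curvFun Φ.smooth (Φ.mem_regularSet_of_inTime ht hx) j)
    integral_same htot
    (Φ.curvFun_boundary B ht (Or.inl rfl)).1 (Φ.curvFun_boundary B ht (Or.inr rfl)).1
    (Φ.curvFun_boundary B ht (Or.inl rfl)).2 (Φ.curvFun_boundary B ht (Or.inr rfl)).2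
  rw [mul_comm]
  exact Φ.hasDerivAt_integral_slice_snd ((hk 0).mul hV) ht hx
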